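/- arXiv:1708.06498 — 7 statements merged into one kernel-verified Lean document; each statement's English description precedes it below -/
import Mathlib

section
/- Let η₀ > 0 and ρ > 0, let X₁, X₂, X₃ be nonnegative real-valued random variables on a probability space, and for t ∈ [0, 1/(1+η₀)] set β₁² = t and β₀² = 1 − t. Define the outage probability P₀(t) = ℙ( (β₀² − β₁²η₀)(X₁² + X₂² + X₃²) + 2β₀²(X₁X₂ + X₁X₃ + X₂X₃) < η₀/ρ ). Then P₀ is monotonically nondecreasing on [0, 1/(1+η₀)]; in fact, for 0 ≤ t₁ ≤ t₂ ≤ 1/(1+η₀) the event defining P₀(t₁) is contained in the event defining P₀(t₂). -/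
open MeasureTheory

/-- Proposition 2: the cell-edge user's outage event (and hence the outage probability)
is monotonically nondecreasing in the near-user power allocation coefficient `t = β₁²`,
where `β₀² = 1 - t`, on `[0, 1/(1+η₀)]`. -/
theorem outage_prob_monotone_in_beta1
    {Ω : Type*} [MeasurableSpace Ω] (μ : Measure Ω) [IsProbabilityMeasure μ]
    (η₀ ρ : ℝ) (hη₀ : 0 < η₀) (hρ : 0 < ρ)
    (X₁ X₂ X₃ : Ω → ℝ)
    (hX₁ : ∀ ω, 0 ≤ X₁ ω) (hX₂ : ∀ ω, 0 ≤ X₂ ω) (hX₃ : ∀ ω, 0 ≤ X₃ ω)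
    (E : ℝ → Set Ω)
    (hE : ∀ t, E t =
      {ω | ((1 - t) - t * η₀) * ((X₁ ω) ^ 2 + (X₂ ω) ^ 2 + (X₃ ω) ^ 2)
        + 2 * (1 - t) * (X₁ ω * X₂ ω + X₁ ω * X₃ ω + X₂ ω * X₃ ω) < η₀ / ρ})
    (t₁ t₂ : ℝ) (ht₁ : 0 ≤ t₁) (ht₁₂ : t₁ ≤ t₂) (ht₂ : t₂ ≤ 1 / (1 + η₀)) :
    E t₁ ⊆ E t₂ ∧ μ (E t₁) ≤ μ (E t₂) := by
  have hsub : E t₁ ⊆ E t₂ := by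
    intro ω hω
    rw [hE, Set.mem_setOf_eq] at hω ⊢
    have h1 := hX₁ ω
    have h2 := hX₂ ω
    have h3 := hX₃ ω
    have hS : 0 ≤ (X₁ ω) ^ 2 + (X₂ ω) ^ 2 + (X₃ ω) ^ 2 := by positivity
    have hP : 0 ≤ X₁ ω * X₂ ω + X₁ ω * X₃ ω + X₂ ω * X₃ ω := by positivity
    refine lt_of_le_of_lt ?_ hω
    gcongr
  exact ⟨hsub, measure_mono hsub⟩
end

section
/- Let η₀ > 0, ρ > 0, and β₀, β₁ > 0 with β₀² + β₁² = 1 and K := β₀² − β₁²η₀ > 0. Define a = β₀²β₁²η₀ − β₁⁴η₀², b = 3β₀²β₁²η₀ − β₁⁴η₀², c = (β₀² − β₁²η₀)η₀/ρ, d = 2β₀⁴ + 3β₀²β₁²η₀ − β₁⁴η₀², φ = √( η₀ / (ρ(2β₀² − β₁²η₀)) ), and for v ≥ u ≥ 0 set X(u,v) = ( √( a u² + b v² + c ) − √2 β₀² v ) / K. Define G(v) = (2/15)( a v⁶/6 + 5 c v⁴/4 + 5 d v⁶/6 ) and let F be the explicit function F(v) = (2√2 β₀² / (48 a^{3/2}))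 [ − c³(2a−b) tanh⁻¹( √a v / √((a+b)v² + c) ) / b² − √a v √((a+b)v² + c) ( b(b−2a)v⁴ + 2bcv² + c² ) / b + v²( b(4a+b)v⁴ + 3(2a+b)cv² + 3c² ) log( (√((a+b)v² + c) + √a v) / √(bv² + c) ) + 2 a^{3/2} c³ log( √(a+b)·√((a+b)v² + c) + (a+b)v ) / (b²√(a+b)) ]. Then ∫₀^φ ∫₀^v X(u,v)² (v² − u²) du dv = ( G(φ) − F(φ) + F(0) ) / (β₀² − β₁²η₀)². -/
/-- The inverse hyperbolic tangent, `tanh⁻¹ x = (1/2) log((1+x)/(1−x))`. -/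
noncomputable def artanh (x : ℝ) : ℝ := (1 / 2) * Real.log ((1 + x) / (1 - x))

lemma q_inner (s q v K e f g : ℝ) (hs : 0 < s) (hq : 0 < q) (hv : 0 ≤ v)
    (Y : ℝ → ℝ)
    (hY : ∀ u, 0 ≤ u → u ≤ v → Y u = ((e * u ^ 2 + f) * (v ^ 2 - u ^ 2)
      - g * (Real.sqrt (s ^ 2 * u ^ 2 + q) * (v ^ 2 - u ^ 2))) * K) :
    ∫ u in (0 : ℝ)..v, Y u = (e * (2 * v ^ 5 / 15) + f * (2 * v ^ 3 / 3)
      - g * ((v ^ 2 + q / (4 * s ^ 2)) * (v * Real.sqrt (s ^ 2 * v ^ 2 + q) / 2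
        + q / (2 * s) * Real.log ((Real.sqrt (s ^ 2 * v ^ 2 + q) + s * v) / Real.sqrt q))
        - v * Real.sqrt (s ^ 2 * v ^ 2 + q) ^ 3 / (4 * s ^ 2))) * K := by
  have hcongr : ∫ u in (0 : ℝ)..v, Y u = ∫ u in (0 : ℝ)..v, ((e * u ^ 2 + f) * (v ^ 2 - u ^ 2)
      - g * (Real.sqrt (s ^ 2 * u ^ 2 + q) * (v ^ 2 - u ^ 2))) * K := by
    apply intervalIntegral.integral_congr
    intro u hu
    rw [Set.uIcc_of_le hv] at hu
    exact hY u hu.1 hu.2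
  rw [hcongr]
  have hder : ∀ u ∈ Set.uIcc 0 v, HasDerivAt (fun u => (e * (u ^ 3 / 3 * v ^ 2 - u ^ 5 / 5)
      + f * (v ^ 2 * u - u ^ 3 / 3)
      - g * ((v ^ 2 + q / (4 * s ^ 2)) * (u * Real.sqrt (s ^ 2 * u ^ 2 + q) / 2
        + q / (2 * s) * Real.log (Real.sqrt (s ^ 2 * u ^ 2 + q) + s * u))
        - u * Real.sqrt (s ^ 2 * u ^ 2 + q) ^ 3 / (4 * s ^ 2))) * K)
      (((e * u ^ 2 + f) * (v ^ 2 - u ^ 2)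
      - g * (Real.sqrt (s ^ 2 * u ^ 2 + q) * (v ^ 2 - u ^ 2))) * K) u := by
    intro u hu
    rw [Set.uIcc_of_le hv] at hu
    have hu0 := hu.1
    have hpos : 0 < s ^ 2 * u ^ 2 + q := by positivity
    have hr : HasDerivAt (fun u => Real.sqrt (s ^ 2 * u ^ 2 + q))
        (s ^ 2 * u / Real.sqrt (s ^ 2 * u ^ 2 + q)) u := by
      have h1 : HasDerivAt (fun u : ℝ => s ^ 2 * u ^ 2 + q) (s ^ 2 * (2 * u)) u := by
        simpa using ((hasDerivAt_pow 2 u).const_mul (s ^ 2)).add_const q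
      convert h1.sqrt hpos.ne' using 1
      field_simp
    have hrp : 0 < Real.sqrt (s ^ 2 * u ^ 2 + q) := Real.sqrt_pos.2 hpos
    have hsq : Real.sqrt (s ^ 2 * u ^ 2 + q) ^ 2 = s ^ 2 * u ^ 2 + q := Real.sq_sqrt hpos.le
    have hlp : 0 < Real.sqrt (s ^ 2 * u ^ 2 + q) + s * u := by positivity
    have hlog : HasDerivAt (fun u => Real.log (Real.sqrt (s ^ 2 * u ^ 2 + q) + s * u))
        (s / Real.sqrt (s ^ 2 * u ^ 2 + q)) u := by
      refine ((hr.add ((hasDerivAt_id u).const_mul s)).log hlp.ne').congr_deriv ?_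
      simp only [Pi.add_apply, id]
      field_simp
      ring
    have h3 := (((hasDerivAt_id u).pow 3).div_const 3).mul_const (v ^ 2)
    have h5 := ((hasDerivAt_id u).pow 5).div_const 5
    have h3' := ((hasDerivAt_id u).pow 3).div_const 3
    have hA := (((h3.sub h5).const_mul e).add
      ((((hasDerivAt_id u).const_mul (v ^ 2)).sub h3').const_mul f)).sub
      ((((((((hasDerivAt_id u).mul hr).div_const 2).add (hlog.const_mul (q / (2 * s)))).const_mul
        (v ^ 2 + q / (4 * s ^ 2)))).sub
        (((hasDerivAt_id u).mul (hr.pow 3)).div_const (4 * s ^ 2))).const_mul g)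
    refine (hA.mul_const K).congr_deriv ?_
    simp only [id, Pi.pow_apply]
    generalize Real.sqrt (s ^ 2 * u ^ 2 + q) = r at *
    have : q = r ^ 2 - s ^ 2 * u ^ 2 := by linarith
    subst this
    push_cast
    field_simp
    ring
  rw [intervalIntegral.integral_eq_sub_of_hasDerivAt hder]
  · have hp : 0 < Real.sqrt (s ^ 2 * v ^ 2 + q) + s * v := by
      have : 0 < Real.sqrt (s ^ 2 * v ^ 2 + q) := Real.sqrt_pos.2 (by positivity)
      positivity
    rw [Real.log_div hp.ne' (Real.sqrt_pos.2 hq).ne']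
    simp
    ring
  · apply Continuous.intervalIntegrable
    fun_prop

lemma q_artanh (s v R q : ℝ) (hs : 0 < s) (hv : 0 ≤ v) (hq : 0 < q) (hR : 0 < R)
    (h : R ^ 2 = s ^ 2 * v ^ 2 + q) :
    artanh (s * v / R) = Real.log ((R + s * v) / Real.sqrt q) := by
  have h1 : 0 < R + s * v := by positivity
  have h2 : 0 < R - s * v := by
    by_contra hh
    nlinarith
  have e : (1 + s * v / R) / (1 - s * v / R) = (R + s * v) ^ 2 / q := by
    have h3 : 1 - s * v / R = (R - s * v) / R := by field_simp
    have h4 : q = (R - s * v) * (R + s * v) := by linarith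
    rw [h3, h4]
    field_simp
  rw [artanh, e, Real.log_div (by positivity) hq.ne', Real.log_div h1.ne' (Real.sqrt_pos.2 hq).ne',
    Real.log_pow, Real.log_sqrt hq.le]
  push_cast
  ring

lemma q_F (s b c t v : ℝ) (hs : 0 < s) (hb : 0 < b) (hc : 0 < c) (ht : 0 < t)
    (htt : t ^ 2 = s ^ 2 + b) (hv : 0 ≤ v) :
    HasDerivAt (fun v => (1 / (48 * s ^ 3)) *
      (-(c ^ 3 * (2 * s ^ 2 - b) * Real.log ((Real.sqrt ((s ^ 2 + b) * v ^ 2 + c) + s * v)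
                / Real.sqrt (b * v ^ 2 + c)) / b ^ 2)
        - s * v * Real.sqrt ((s ^ 2 + b) * v ^ 2 + c)
            * (b * (b - 2 * s ^ 2) * v ^ 4 + 2 * b * c * v ^ 2 + c ^ 2) / b
        + v ^ 2 * (b * (4 * s ^ 2 + b) * v ^ 4 + 3 * (2 * s ^ 2 + b) * c * v ^ 2 + 3 * c ^ 2)
            * Real.log ((Real.sqrt ((s ^ 2 + b) * v ^ 2 + c) + s * v)
                / Real.sqrt (b * v ^ 2 + c))
        + 2 * s ^ 3 * c ^ 3
            * Real.log (t * Real.sqrt ((s ^ 2 + b) * v ^ 2 + c) + (s ^ 2 + b) * v)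
            / (b ^ 2 * t)))
    (v * ((v ^ 2 + (b * v ^ 2 + c) / (4 * s ^ 2)) * (v * Real.sqrt ((s ^ 2 + b) * v ^ 2 + c) / 2
        + (b * v ^ 2 + c) / (2 * s) * Real.log ((Real.sqrt ((s ^ 2 + b) * v ^ 2 + c) + s * v)
          / Real.sqrt (b * v ^ 2 + c)))
        - v * Real.sqrt ((s ^ 2 + b) * v ^ 2 + c) ^ 3 / (4 * s ^ 2))) v := by
  have hsqrt : ∀ k : ℝ, 0 < k → HasDerivAt (fun v => Real.sqrt (k * v ^ 2 + c))
        (k * v / Real.sqrt (k * v ^ 2 + c)) v := by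
    intro k hk
    have hpos : 0 < k * v ^ 2 + c := by positivity
    have h1 : HasDerivAt (fun v : ℝ => k * v ^ 2 + c) (k * (2 * v)) v := by
      simpa using ((hasDerivAt_pow 2 v).const_mul k).add_const c
    convert h1.sqrt hpos.ne' using 1
    field_simp
  have hR := hsqrt (s ^ 2 + b) (by positivity)
  have hQ := hsqrt b hb
  have hRp : 0 < Real.sqrt ((s ^ 2 + b) * v ^ 2 + c) := Real.sqrt_pos.2 (by positivity)
  have hQp : 0 < Real.sqrt (b * v ^ 2 + c) := Real.sqrt_pos.2 (by positivity)
  have hRs : Real.sqrt ((s ^ 2 + b) * v ^ 2 + c) ^ 2 = (s ^ 2 + b) * v ^ 2 + c :=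
    Real.sq_sqrt (by positivity)
  have hQs : Real.sqrt (b * v ^ 2 + c) ^ 2 = b * v ^ 2 + c := Real.sq_sqrt (by positivity)
  have hl : HasDerivAt (fun v => Real.log ((Real.sqrt ((s ^ 2 + b) * v ^ 2 + c) + s * v)
                / Real.sqrt (b * v ^ 2 + c)))
      (s * c / (Real.sqrt ((s ^ 2 + b) * v ^ 2 + c) * (b * v ^ 2 + c))) v := by
    have h0 : (Real.sqrt ((s ^ 2 + b) * v ^ 2 + c) + s * v)
                / Real.sqrt (b * v ^ 2 + c) ≠ 0 := by positivity
    refine (((hR.add ((hasDerivAt_id v).const_mul s)).div hQ hQp.ne').log h0).congr_deriv ?_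
    simp only [Pi.add_apply, Pi.div_apply, id]
    have hlp : 0 < Real.sqrt ((s ^ 2 + b) * v ^ 2 + c) + s * v := by positivity
    have hq : 0 < b * v ^ 2 + c := by positivity
    generalize Real.sqrt ((s ^ 2 + b) * v ^ 2 + c) = R at *
    generalize Real.sqrt (b * v ^ 2 + c) = Q at *
    rw [← hQs]
    have hc' : c = Q ^ 2 - b * v ^ 2 := by linarith
    have hR2 : R ^ 2 = s ^ 2 * v ^ 2 + Q ^ 2 := by linarith
    field_simp
    rw [hc']
    linear_combination (-b * v) * hR2
  have hM : HasDerivAt (fun v => Real.log (t * Real.sqrt ((s ^ 2 + b) * v ^ 2 + c)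
      + (s ^ 2 + b) * v)) (t / Real.sqrt ((s ^ 2 + b) * v ^ 2 + c)) v := by
    have h0 : t * Real.sqrt ((s ^ 2 + b) * v ^ 2 + c) + (s ^ 2 + b) * v ≠ 0 := by positivity
    refine (((hR.const_mul t).add ((hasDerivAt_id v).const_mul (s ^ 2 + b))).log h0).congr_deriv ?_
    simp only [Pi.add_apply, id]
    generalize Real.sqrt ((s ^ 2 + b) * v ^ 2 + c) = R at *
    rw [← htt] at *
    field_simp
    ring
  have hid := hasDerivAt_id v
  have T1 := ((hl.const_mul (c ^ 3 * (2 * s ^ 2 - b))).div_const (b ^ 2)).neg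
  have T2 := (((hid.const_mul s).mul hR).mul
    ((((hid.pow 4).const_mul (b * (b - 2 * s ^ 2))).add
      ((hid.pow 2).const_mul (2 * b * c))).add_const (c ^ 2))).div_const b
  have T3 := ((hid.pow 2).mul ((((hid.pow 4).const_mul (b * (4 * s ^ 2 + b))).add
      ((hid.pow 2).const_mul (3 * (2 * s ^ 2 + b) * c))).add_const (3 * c ^ 2))).mul hl
  have T4 := (hM.const_mul (2 * s ^ 3 * c ^ 3)).div_const (b ^ 2 * t)
  refine ((((T1.sub T2).add T3).add T4).const_mul (1 / (48 * s ^ 3))).congr_deriv ?_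
  simp only [Pi.add_apply, Pi.pow_apply, Pi.mul_apply, id]
  have hq : 0 < b * v ^ 2 + c := by positivity
  generalize Real.log ((Real.sqrt ((s ^ 2 + b) * v ^ 2 + c) + s * v)
                / Real.sqrt (b * v ^ 2 + c)) = L at *
  clear T1 T2 T3 T4 hl hM hR hQ hQs hQp hsqrt hid
  generalize Real.sqrt ((s ^ 2 + b) * v ^ 2 + c) = R at *
  have hc' : c = R ^ 2 - (s ^ 2 + b) * v ^ 2 := by linarith
  have hq' : b * v ^ 2 + c = R ^ 2 - s ^ 2 * v ^ 2 := by linarith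
  rw [hq'] at hq ⊢
  subst hc'
  push_cast
  field_simp
  ring

/-- Appendix A / Lemma 1: closed-form evaluation of the dominant part `Q₁₁` of the outage
integral, `∫₀^φ ∫₀^v X(u,v)² (v² − u²) du dv = (G(φ) − F(φ) + F(0)) / (β₀² − β₁²η₀)²`. -/
theorem Q11_closed_form
    (η₀ ρ β₀ β₁ : ℝ) (hη₀ : 0 < η₀) (hρ : 0 < ρ)
    (hβ₀ : 0 < β₀) (hβ₁ : 0 < β₁) (hβ : β₀ ^ 2 + β₁ ^ 2 = 1)
    (K : ℝ) (hKdef : K = β₀ ^ 2 - β₁ ^ 2 * η₀) (hK : 0 < K)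
    (a b c d φ : ℝ)
    (ha : a = β₀ ^ 2 * β₁ ^ 2 * η₀ - β₁ ^ 4 * η₀ ^ 2)
    (hb : b = 3 * β₀ ^ 2 * β₁ ^ 2 * η₀ - β₁ ^ 4 * η₀ ^ 2)
    (hc : c = (β₀ ^ 2 - β₁ ^ 2 * η₀) * η₀ / ρ)
    (hd : d = 2 * β₀ ^ 4 + 3 * β₀ ^ 2 * β₁ ^ 2 * η₀ - β₁ ^ 4 * η₀ ^ 2)
    (hφ : φ = Real.sqrt (η₀ / (ρ * (2 * β₀ ^ 2 - β₁ ^ 2 * η₀))))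
    (X : ℝ → ℝ → ℝ)
    (hX : ∀ u v, 0 ≤ u → u ≤ v →
      X u v = (Real.sqrt (a * u ^ 2 + b * v ^ 2 + c) - Real.sqrt 2 * β₀ ^ 2 * v) / K)
    (G F : ℝ → ℝ)
    (hG : ∀ v, G v = (2 / 15) * (a * v ^ 6 / 6 + 5 * c * v ^ 4 / 4 + 5 * d * v ^ 6 / 6))
    (hF : ∀ v, F v = (2 * Real.sqrt 2 * β₀ ^ 2 / (48 * a ^ ((3 : ℝ) / 2))) *
      (-(c ^ 3 * (2 * a - b) * artanh (Real.sqrt a * v / Real.sqrt ((a + b) * v ^ 2 + c)) / b ^ 2)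
        - Real.sqrt a * v * Real.sqrt ((a + b) * v ^ 2 + c)
            * (b * (b - 2 * a) * v ^ 4 + 2 * b * c * v ^ 2 + c ^ 2) / b
        + v ^ 2 * (b * (4 * a + b) * v ^ 4 + 3 * (2 * a + b) * c * v ^ 2 + 3 * c ^ 2)
            * Real.log ((Real.sqrt ((a + b) * v ^ 2 + c) + Real.sqrt a * v)
                / Real.sqrt (b * v ^ 2 + c))
        + 2 * a ^ ((3 : ℝ) / 2) * c ^ 3
            * Real.log (Real.sqrt (a + b) * Real.sqrt ((a + b) * v ^ 2 + c) + (a + b) * v)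
            / (b ^ 2 * Real.sqrt (a + b)))) :
    ∫ v in (0 : ℝ)..φ, ∫ u in (0 : ℝ)..v, X u v ^ 2 * (v ^ 2 - u ^ 2)
      = (G φ - F φ + F 0) / (β₀ ^ 2 - β₁ ^ 2 * η₀) ^ 2 := by
  have hKpos : 0 < β₀ ^ 2 - β₁ ^ 2 * η₀ := hKdef ▸ hK
  have hapos : 0 < a := by
    have : a = β₁ ^ 2 * η₀ * (β₀ ^ 2 - β₁ ^ 2 * η₀) := by rw [ha]; ring
    rw [this]; positivity
  have hbpos : 0 < b := by
    have : b = a + 2 * β₀ ^ 2 * β₁ ^ 2 * η₀ := by rw [ha, hb]; ring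
    rw [this]; positivity
  have hcpos : 0 < c := by rw [hc]; positivity
  have hφ0 : 0 ≤ φ := hφ ▸ Real.sqrt_nonneg _
  have hd' : d = 2 * β₀ ^ 4 + b := by rw [hd, hb]; ring
  rw [← hKdef]
  clear hd hφ hc ha hb hKpos hKdef hβ
  obtain ⟨s, hs, rfl⟩ : ∃ s : ℝ, 0 < s ∧ a = s ^ 2 :=
    ⟨Real.sqrt a, Real.sqrt_pos.2 hapos, (Real.sq_sqrt hapos.le).symm⟩
  have ht : 0 < Real.sqrt (s ^ 2 + b) := Real.sqrt_pos.2 (by positivity)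
  have htt : Real.sqrt (s ^ 2 + b) ^ 2 = s ^ 2 + b := Real.sq_sqrt (by positivity)
  have hs3 : (s ^ 2) ^ ((3 : ℝ) / 2) = s ^ 3 := by
    rw [← Real.rpow_natCast, ← Real.rpow_mul hs.le, ← Real.rpow_natCast]
    norm_num
  have hss : Real.sqrt (s ^ 2) = s := Real.sqrt_sq hs.le
  rw [hs3, hss] at hF
  have hFd := fun v => q_F s b c _ v hs hbpos hcpos ht htt
  set f : ℝ → ℝ := fun v => (1 / (48 * s ^ 3)) *
      (-(c ^ 3 * (2 * s ^ 2 - b) * Real.log ((Real.sqrt ((s ^ 2 + b) * v ^ 2 + c) + s * v)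
                / Real.sqrt (b * v ^ 2 + c)) / b ^ 2)
        - s * v * Real.sqrt ((s ^ 2 + b) * v ^ 2 + c)
            * (b * (b - 2 * s ^ 2) * v ^ 4 + 2 * b * c * v ^ 2 + c ^ 2) / b
        + v ^ 2 * (b * (4 * s ^ 2 + b) * v ^ 4 + 3 * (2 * s ^ 2 + b) * c * v ^ 2 + 3 * c ^ 2)
            * Real.log ((Real.sqrt ((s ^ 2 + b) * v ^ 2 + c) + s * v)
                / Real.sqrt (b * v ^ 2 + c))
        + 2 * s ^ 3 * c ^ 3
            * Real.log (Real.sqrt (s ^ 2 + b) * Real.sqrt ((s ^ 2 + b) * v ^ 2 + c)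
              + (s ^ 2 + b) * v)
            / (b ^ 2 * Real.sqrt (s ^ 2 + b))) with hf
  have hFf : ∀ v, 0 ≤ v → F v = (Real.sqrt 2 * β₀ ^ 2 * 2) * f v := by
    intro v hv
    rw [hF, q_artanh s v _ (b * v ^ 2 + c) hs hv (by positivity)
      (Real.sqrt_pos.2 (by positivity)) (by rw [Real.sq_sqrt (by positivity)]; ring), hf]
    ring
  set g : ℝ → ℝ := fun v => v * ((v ^ 2 + (b * v ^ 2 + c) / (4 * s ^ 2)) *
        (v * Real.sqrt ((s ^ 2 + b) * v ^ 2 + c) / 2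
        + (b * v ^ 2 + c) / (2 * s) * Real.log ((Real.sqrt ((s ^ 2 + b) * v ^ 2 + c) + s * v)
          / Real.sqrt (b * v ^ 2 + c)))
        - v * Real.sqrt ((s ^ 2 + b) * v ^ 2 + c) ^ 3 / (4 * s ^ 2)) with hg
  have h2 : Real.sqrt 2 ^ 2 = 2 := Real.sq_sqrt (by norm_num)
  have hin : ∀ v, 0 ≤ v → ∫ u in (0 : ℝ)..v, X u v ^ 2 * (v ^ 2 - u ^ 2) =
      (2 / 15 * (s ^ 2 * v ^ 5 + 5 * c * v ^ 3 + 5 * d * v ^ 5)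
        - Real.sqrt 2 * β₀ ^ 2 * 2 * g v) / K ^ 2 := by
    intro v hv
    rw [q_inner s (b * v ^ 2 + c) v (1 / K ^ 2) (s ^ 2) (d * v ^ 2 + c)
      (2 * Real.sqrt 2 * β₀ ^ 2 * v) hs (by positivity) hv]
    · have : s ^ 2 * v ^ 2 + (b * v ^ 2 + c) = (s ^ 2 + b) * v ^ 2 + c := by ring
      rw [this, hg]
      ring
    · intro u hu huv
      rw [hX u v hu huv]
      have e : s ^ 2 * u ^ 2 + b * v ^ 2 + c = s ^ 2 * u ^ 2 + (b * v ^ 2 + c) := by ring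
      rw [e]
      have hr : Real.sqrt (s ^ 2 * u ^ 2 + (b * v ^ 2 + c)) ^ 2
          = s ^ 2 * u ^ 2 + (b * v ^ 2 + c) := Real.sq_sqrt (by positivity)
      generalize Real.sqrt (s ^ 2 * u ^ 2 + (b * v ^ 2 + c)) = r at *
      rw [div_pow, hd']
      field_simp
      linear_combination (v ^ 2 - u ^ 2) * hr + (v ^ 2 - u ^ 2) * β₀ ^ 4 * v ^ 2 * h2
  have hcongr : ∫ v in (0 : ℝ)..φ, ∫ u in (0 : ℝ)..v, X u v ^ 2 * (v ^ 2 - u ^ 2)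
      = ∫ v in (0 : ℝ)..φ, (2 / 15 * (s ^ 2 * v ^ 5 + 5 * c * v ^ 3 + 5 * d * v ^ 5)
        - Real.sqrt 2 * β₀ ^ 2 * 2 * g v) / K ^ 2 := by
    apply intervalIntegral.integral_congr
    intro v hv
    rw [Set.uIcc_of_le hφ0] at hv
    exact hin v hv.1
  rw [hcongr, intervalIntegral.integral_eq_sub_of_hasDerivAt (f := fun v =>
    (G v - Real.sqrt 2 * β₀ ^ 2 * 2 * f v) / K ^ 2)]
  · rw [hFf φ hφ0, hFf 0 le_rfl, hG 0]
    ring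
  · intro v hv
    rw [Set.uIcc_of_le hφ0] at hv
    have hGd : HasDerivAt G (2 / 15 * (s ^ 2 * v ^ 5 + 5 * c * v ^ 3 + 5 * d * v ^ 5)) v := by
      rw [funext hG]
      have hid := hasDerivAt_id v
      refine ((((((hid.pow 6).const_mul (s ^ 2)).div_const 6).add
        (((hid.pow 4).const_mul (5 * c)).div_const 4)).add
        (((hid.pow 6).const_mul (5 * d)).div_const 6)).const_mul (2 / 15)).congr_deriv ?_
      simp only [id]
      push_cast
      ring
    exact (hGd.sub ((hFd v hv.1).const_mul _)).div_const _
  · apply ContinuousOn.intervalIntegrable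
    rw [Set.uIcc_of_le hφ0]
    have hlc : ContinuousOn (fun v => Real.log ((Real.sqrt ((s ^ 2 + b) * v ^ 2 + c) + s * v)
          / Real.sqrt (b * v ^ 2 + c))) (Set.Icc 0 φ) := by
      have hQp : ∀ v ∈ Set.Icc 0 φ, Real.sqrt (b * v ^ 2 + c) ≠ 0 := fun v _ =>
        (Real.sqrt_pos.2 (by positivity)).ne'
      refine ContinuousOn.log (ContinuousOn.div (by fun_prop) (by fun_prop) hQp) ?_
      intro v hv
      have hR : 0 < Real.sqrt ((s ^ 2 + b) * v ^ 2 + c) := Real.sqrt_pos.2 (by positivity)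
      have hv0 := hv.1
      exact div_ne_zero (by positivity) (hQp v hv)
    rw [hg]
    fun_prop
end

section
/- Let l > 0 and let P₁, P₂, P₃ ∈ ℝ² be the vertices of an equilateral triangle of side length l. Let R₀ satisfy (√3/3)l ≤ R₀ ≤ (√3/2)l, and let A = { p ∈ ℝ² : |p − Pᵢ| ≤ R₀ for i = 1, 2, 3 } be the intersection of the three closed discs of radius R₀ centered at the vertices. Then the Lebesgue measure (area) of A equals S_A = 3R₀²( π/3 − arcsin( l/(2R₀) ) ) − √3 l R₀ sin( π/3 − arcsin( l/(2R₀) ) ). -/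
open MeasureTheory Real

lemma tdi_frame (l : ℝ) (hl : 0 < l)
    (P₁ P₂ P₃ : EuclideanSpace ℝ (Fin 2))
    (h12 : dist P₁ P₂ = l) (h13 : dist P₁ P₃ = l) (h23 : dist P₂ P₃ = l) :
    ∃ f : ℝ × ℝ → EuclideanSpace ℝ (Fin 2), MeasurePreserving f ∧
      (∀ q, dist (f q) P₁ = √((q.1 + l/2)^2 + q.2^2)) ∧
      (∀ q, dist (f q) P₂ = √((q.1 - l/2)^2 + q.2^2)) ∧
      (∀ q, dist (f q) P₃ = √(q.1^2 + (q.2 - √3/2*l)^2)) := by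
  have s3 : √3 ^ 2 = 3 := Real.sq_sqrt (by norm_num)
  have s3p : 0 < √3 := by positivity
  obtain ⟨a, ha⟩ : ∃ a, a = P₂ - P₁ := ⟨_, rfl⟩
  obtain ⟨c, hc⟩ : ∃ c, c = P₃ - P₁ := ⟨_, rfl⟩
  have haa : inner ℝ a a = l^2 := by
    rw [real_inner_self_eq_norm_sq, ha, ← dist_eq_norm, dist_comm, h12]
  have hcc : inner ℝ c c = l^2 := by
    rw [real_inner_self_eq_norm_sq, hc, ← dist_eq_norm, dist_comm, h13]
  have hac : inner ℝ a c = l^2/2 := by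
    have h : inner ℝ (a - c) (a - c) = l^2 := by
      rw [real_inner_self_eq_norm_sq, ha, hc, sub_sub_sub_cancel_right, ← dist_eq_norm, h23]
    rw [real_inner_sub_sub_self, haa, hcc] at h
    linarith
  have hca : inner ℝ c a = l^2/2 := by rw [real_inner_comm, hac]
  let v : Fin 2 → EuclideanSpace ℝ (Fin 2) := ![(1/l) • a, (2/(√3*l)) • (c - (1/2:ℝ) • a)]
  have hv : Orthonormal ℝ v := by
    rw [orthonormal_iff_ite]
    intro i j
    fin_cases i <;> fin_cases j <;>
      simp [v, inner_smul_left, inner_smul_right, inner_sub_left, inner_sub_right,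
        -inner_self_eq_norm_sq_to_K, haa, hcc, hac, hca] <;>
      field_simp <;> (try rw [s3]) <;> (try simp) <;> norm_num
  let b0 := basisOfOrthonormalOfCardEqFinrank hv (by simp)
  have hb0 : ⇑b0 = v := coe_basisOfOrthonormalOfCardEqFinrank hv (by simp)
  let b := b0.toOrthonormalBasis (by rw [hb0]; exact hv)
  have hb : ⇑b = v := by simp [b, hb0]
  let M : EuclideanSpace ℝ (Fin 2) := P₁ + (1/2:ℝ) • a
  let g : ℝ × ℝ → EuclideanSpace ℝ (Fin 2) := fun q => M + b.repr.symm (!₂[q.1, q.2])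
  have hdist : ∀ q r, dist (g q) (g r) = √((q.1 - r.1)^2 + (q.2 - r.2)^2) := by
    intro q r
    simp only [g, dist_add_left, LinearIsometryEquiv.dist_map, EuclideanSpace.dist_eq]
    simp [Fin.sum_univ_two, Real.dist_eq, sq_abs]
  have hg : ∀ q, g q = M + (q.1 • v 0 + q.2 • v 1) := by
    intro q
    simp only [g, ← b.sum_repr_symm, Fin.sum_univ_two, hb]
    simp
  have e1 : P₁ = g (-(l/2), 0) := by
    rw [hg]; simp only [M, v]; simp [smul_smul]
    rw [show (l/2 * l⁻¹) = (2:ℝ)⁻¹ by field_simp]; module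
  have e2 : P₂ = g (l/2, 0) := by
    rw [hg]; simp only [M, v]; simp [smul_smul]
    rw [show (l/2 * l⁻¹) = (2:ℝ)⁻¹ by field_simp, ha]; module
  have e3 : P₃ = g (0, √3/2*l) := by
    rw [hg]; simp only [M, v]; simp [smul_smul]
    rw [show (√3/2*l * (2 / (√3 * l))) = (1:ℝ) by field_simp, hc]; module
  refine ⟨g, ?_, ?_, ?_, ?_⟩
  · have h1 : MeasurePreserving (fun q : ℝ × ℝ => (!₂[q.1, q.2] : EuclideanSpace ℝ (Fin 2))) :=
      (EuclideanSpace.volume_preserving_symm_measurableEquiv_toLp (Fin 2)).symm.comp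
        (volume_preserving_finTwoArrow ℝ).symm
    exact (measurePreserving_add_left volume M).comp (b.measurePreserving_repr_symm.comp h1)
  · intro q; rw [e1, hdist]; simp
  · intro q; rw [e2, hdist]; simp
  · intro q; rw [e3, hdist]; simp

lemma tdi_int (R a b : ℝ) (hR : 0 < R) (ha : 0 ≤ a) (hab : a ≤ b) (hb : b ≤ R) :
    ∫ x in a..b, √(R^2 - x^2) =
      (b * √(R^2-b^2) + R^2 * arcsin (b/R)) / 2 - (a * √(R^2-a^2) + R^2 * arcsin (a/R)) / 2 := by
  refine intervalIntegral.integral_eq_sub_of_hasDerivAt_of_le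
    (f := fun x => (x * √(R^2-x^2) + R^2 * arcsin (x/R)) / 2) hab ?_ ?_ ?_
  · fun_prop
  · intro x hx
    have hx0 : 0 < x := by linarith [hx.1]
    have hxR : x < R := by linarith [hx.2]
    have hp : 0 < R^2 - x^2 := by nlinarith
    have hs : √(R^2-x^2)^2 = R^2 - x^2 := Real.sq_sqrt hp.le
    have hsp : 0 < √(R^2-x^2) := Real.sqrt_pos.2 hp
    have d1 : HasDerivAt (fun x => √(R^2-x^2)) ((-(2*x)) / (2 * √(R^2-x^2))) x := by
      refine HasDerivAt.sqrt ?_ hp.ne'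
      simpa using ((hasDerivAt_pow 2 x).const_sub (R^2))
    have hq : √(1 - (x/R)^2) = √(R^2-x^2) / R := by
      rw [show 1 - (x/R)^2 = (R^2-x^2)/R^2 by field_simp, Real.sqrt_div hp.le, Real.sqrt_sq hR.le]
    have hxr1 : x / R < 1 := (div_lt_one hR).2 hxR
    have hxr0 : 0 < x / R := by positivity
    have d2 : HasDerivAt (fun x => arcsin (x/R)) ((1 / √(1 - (x/R)^2)) * (1/R)) x :=
      (Real.hasDerivAt_arcsin (by linarith) (by linarith)).comp x ((hasDerivAt_id x).div_const R)
    rw [hq] at d2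
    refine ((((hasDerivAt_id x).mul d1).add (d2.const_mul (R^2))).div_const 2).congr_deriv ?_
    simp only [id]
    field_simp
    rw [hs]; ring
  · exact (by fun_prop : Continuous fun x : ℝ => √(R^2 - x^2)).intervalIntegrable _ _

lemma tdi_planar (l R X Y h : ℝ) (hl : 0 < l) (hR : 0 < R) (hX : 0 ≤ X) (hY : 0 ≤ Y) (hYh : Y ≤ h)
    (hRh : R ≤ h) (e1 : (X + l/2)^2 + Y^2 = R^2) (e2 : X^2 + (h - Y)^2 = R^2) :
    (volume {q : ℝ × ℝ | (q.1 + l/2)^2 + q.2^2 ≤ R^2 ∧ (q.1 - l/2)^2 + q.2^2 ≤ R^2 ∧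
      q.1^2 + (q.2 - h)^2 ≤ R^2}).toReal =
    2 * ∫ x in 0..X, (√(R^2 - (x + l/2)^2) + √(R^2 - x^2) - h) := by
  set S := {q : ℝ × ℝ | (q.1 + l/2)^2 + q.2^2 ≤ R^2 ∧ (q.1 - l/2)^2 + q.2^2 ≤ R^2 ∧
      q.1^2 + (q.2 - h)^2 ≤ R^2} with hS
  have hmeas : MeasurableSet S := by
    apply IsClosed.measurableSet
    rw [hS]
    simp only [Set.ofPred_and]
    refine IsClosed.inter ?_ (IsClosed.inter ?_ ?_) <;>
      exact isClosed_le (by fun_prop) (by fun_prop)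
  let G : ℝ → ℝ := fun x => √(R^2 - (|x| + l/2)^2) + √(R^2 - x^2) - h
  have hGc : Continuous G := by fun_prop
  -- membership in terms of |x|
  have hmem : ∀ x y : ℝ, (x, y) ∈ S ↔ ((|x| + l/2)^2 + y^2 ≤ R^2 ∧ x^2 + (y - h)^2 ≤ R^2) := by
    intro x y
    simp only [hS, Set.mem_ofPred_eq]
    rcases abs_cases x with ⟨ha, hx⟩ | ⟨ha, hx⟩ <;> rw [ha]
    · constructor
      · rintro ⟨h1, h2, h3⟩; exact ⟨h1, h3⟩
      · rintro ⟨h1, h3⟩; exact ⟨h1, by nlinarith, h3⟩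
    · constructor
      · rintro ⟨h1, h2, h3⟩; exact ⟨by nlinarith, h3⟩
      · rintro ⟨h1, h3⟩; exact ⟨by nlinarith, by nlinarith, h3⟩
  have hybd : ∀ x y : ℝ, (x, y) ∈ S → 0 ≤ y ∧ y ≤ h := by
    intro x y hxy
    obtain ⟨h1, h2⟩ := (hmem x y).1 hxy
    have a1 : |y - h| ≤ R := abs_le_of_sq_le_sq (by nlinarith [sq_nonneg x]) hR.le
    have a2 : |y| ≤ R := abs_le_of_sq_le_sq (by nlinarith [sq_nonneg (|x| + l/2)]) hR.le
    rw [abs_le] at a1 a2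
    constructor <;> linarith [a1.1, a2.2]
  have hslice : ∀ x : ℝ, volume (Prod.mk x ⁻¹' S) =
      (Set.Icc (-X) X).indicator (fun x => ENNReal.ofReal (G x)) x := by
    intro x
    by_cases hx : x ∈ Set.Icc (-X) X
    · rw [Set.indicator_of_mem hx]
      have hax : |x| ≤ X := abs_le.2 hx
      have hax0 := abs_nonneg x
      have hsq : |x|^2 = x^2 := sq_abs x
      have p1 : 0 ≤ R^2 - (|x| + l/2)^2 := by nlinarith
      have p2 : 0 ≤ R^2 - x^2 := by nlinarith
      have : Prod.mk x ⁻¹' S = Set.Icc (h - √(R^2 - x^2)) (√(R^2 - (|x| + l/2)^2)) := by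
        ext y
        constructor
        · intro hy
          obtain ⟨y0, yh⟩ := hybd x y hy
          obtain ⟨h1, h2⟩ := (hmem x y).1 hy
          constructor
          · have : h - y ≤ √(R^2 - x^2) := Real.le_sqrt_of_sq_le (by nlinarith)
            linarith
          · exact Real.le_sqrt_of_sq_le (by nlinarith)
        · rintro ⟨h1, h2⟩
          have q1 := Real.sq_sqrt p1
          have q2 := Real.sq_sqrt p2
          have r1 := Real.sqrt_nonneg (R^2 - (|x| + l/2)^2)
          have r2 := Real.sqrt_nonneg (R^2 - x^2)
          have t1 : √(R^2 - (|x| + l/2)^2) ≤ R := Real.sqrt_le_iff.2 ⟨hR.le, by nlinarith⟩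
          have t2 : √(R^2 - x^2) ≤ R := Real.sqrt_le_iff.2 ⟨hR.le, by nlinarith⟩
          refine (hmem x y).2 ⟨?_, ?_⟩
          · have : 0 ≤ y := by linarith
            nlinarith
          · have : y ≤ h := by linarith
            nlinarith
      rw [this, Real.volume_Icc]
      congr 1
      simp only [G]; ring
    · rw [Set.indicator_of_notMem hx]
      have hax : X < |x| := by
        by_contra hcon
        exact hx (abs_le.1 (not_lt.1 hcon))
      have : Prod.mk x ⁻¹' S = ∅ := by
        rw [Set.eq_empty_iff_forall_notMem]
        intro y hy
        obtain ⟨y0, yh⟩ := hybd x y hy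
        obtain ⟨h1, h2⟩ := (hmem x y).1 hy
        have hsq : |x|^2 = x^2 := sq_abs x
        have k1 : y < Y := by
          apply lt_of_pow_lt_pow_left₀ 2 hY
          nlinarith
        have k2 : h - y < h - Y := by
          apply lt_of_pow_lt_pow_left₀ 2 (by linarith)
          nlinarith
        linarith
      rw [this, measure_empty]
  have hGnn : ∀ x ∈ Set.Icc (-X) X, 0 ≤ G x := by
    intro x hx
    have hax : |x| ≤ X := abs_le.2 hx
    have hax0 := abs_nonneg x
    have hsq : |x|^2 = x^2 := sq_abs x
    have k1 : Y ≤ √(R^2 - (|x| + l/2)^2) := Real.le_sqrt_of_sq_le (by nlinarith)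
    have k2 : h - Y ≤ √(R^2 - x^2) := Real.le_sqrt_of_sq_le (by nlinarith)
    simp only [G]; linarith
  have hvol : volume S = ENNReal.ofReal (∫ x in Set.Icc (-X) X, G x) := by
    rw [Measure.volume_eq_prod, Measure.prod_apply hmeas]
    simp_rw [hslice]
    rw [lintegral_indicator measurableSet_Icc, ofReal_integral_eq_lintegral_ofReal]
    · exact hGc.integrableOn_Icc
    · exact (ae_restrict_iff' measurableSet_Icc).2 (Filter.Eventually.of_forall hGnn)
  have hint : ∫ x in Set.Icc (-X) X, G x = 2 * ∫ x in 0..X, G x := by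
    rw [integral_Icc_eq_integral_Ioc, ← intervalIntegral.integral_of_le (by linarith),
      ← intervalIntegral.integral_add_adjacent_intervals (b := 0)
        (hGc.intervalIntegrable _ _) (hGc.intervalIntegrable _ _)]
    have : ∫ x in (-X)..0, G x = ∫ x in 0..X, G x := by
      have := intervalIntegral.integral_comp_neg (a := 0) (b := X) G
      rw [neg_zero] at this
      rw [← this]
      simp [G]
    rw [this]; ring
  rw [hvol, ENNReal.toReal_ofReal (setIntegral_nonneg measurableSet_Icc hGnn), hint]
  congr 1
  apply intervalIntegral.integral_congr
  intro x hx
  rw [Set.uIcc_of_le hX] at hx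
  simp only [G, abs_of_nonneg hx.1]

set_option maxHeartbeats 2000000 in
theorem area_of_triple_disc_intersection
    (l R₀ : ℝ) (hl : 0 < l)
    (P₁ P₂ P₃ : EuclideanSpace ℝ (Fin 2))
    (h12 : dist P₁ P₂ = l) (h13 : dist P₁ P₃ = l) (h23 : dist P₂ P₃ = l)
    (hR₀l : Real.sqrt 3 / 3 * l ≤ R₀) (hR₀u : R₀ ≤ Real.sqrt 3 / 2 * l) :
    (volume {p : EuclideanSpace ℝ (Fin 2) |
        dist p P₁ ≤ R₀ ∧ dist p P₂ ≤ R₀ ∧ dist p P₃ ≤ R₀}).toReal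
      = 3 * R₀ ^ 2 * (π / 3 - Real.arcsin (l / (2 * R₀)))
        - Real.sqrt 3 * l * R₀ * Real.sin (π / 3 - Real.arcsin (l / (2 * R₀))) := by
  have s3 : √3 ^ 2 = 3 := Real.sq_sqrt (by norm_num)
  have s3p : 0 < √3 := by positivity
  have hR : 0 < R₀ := lt_of_lt_of_le (by positivity) hR₀l
  obtain ⟨f, hf, d1, d2, d3⟩ := tdi_frame l hl P₁ P₂ P₃ h12 h13 h23
  have hclosed : IsClosed {p : EuclideanSpace ℝ (Fin 2) |
        dist p P₁ ≤ R₀ ∧ dist p P₂ ≤ R₀ ∧ dist p P₃ ≤ R₀} := by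
    simp only [Set.ofPred_and]
    refine IsClosed.inter ?_ (IsClosed.inter ?_ ?_) <;>
      exact isClosed_le (by fun_prop) (by fun_prop)
  rw [← hf.measure_preimage hclosed.measurableSet.nullMeasurableSet]
  have hpre : f ⁻¹' {p : EuclideanSpace ℝ (Fin 2) |
        dist p P₁ ≤ R₀ ∧ dist p P₂ ≤ R₀ ∧ dist p P₃ ≤ R₀} =
      {q : ℝ × ℝ | (q.1 + l/2)^2 + q.2^2 ≤ R₀^2 ∧ (q.1 - l/2)^2 + q.2^2 ≤ R₀^2 ∧
      q.1^2 + (q.2 - √3/2*l)^2 ≤ R₀^2} := by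
    ext q
    simp only [Set.mem_preimage, Set.mem_ofPred_eq, d1, d2, d3, Real.sqrt_le_left hR.le]
  rw [hpre]
  clear hpre hclosed d1 d2 d3 hf f h12 h13 h23 P₁ P₂ P₃
  obtain ⟨α, hα⟩ : ∃ α, α = Real.arcsin (l / (2 * R₀)) := ⟨_, rfl⟩
  obtain ⟨s, hs⟩ : ∃ s, s = l / (2 * R₀) := ⟨_, rfl⟩
  have hls : l = 2 * R₀ * s := by rw [hs]; field_simp
  have hs0 : 0 < s := by rw [hs]; positivity
  have hsu : s ≤ √3/2 := by
    rw [hs, div_le_iff₀ (by positivity)]; nlinarith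
  have hsl : √3/3 ≤ s := by
    rw [hs, le_div_iff₀ (by positivity)]; nlinarith
  have hs2 : s^2 ≤ 3/4 := by nlinarith
  have hs3 : 1/3 ≤ s^2 := by nlinarith
  have hsh : 1/2 ≤ s := by nlinarith
  have hs1 : s ≤ 1 := by nlinarith
  have hsin : sin α = s := by
    rw [hα, ← hs]; exact Real.sin_arcsin (by linarith) hs1
  have hα3 : α ≤ π/3 := by
    rw [hα, ← hs, Real.arcsin_le_iff_le_sin ⟨by linarith, hs1⟩ ⟨by linarith [pi_pos], by linarith [pi_pos]⟩,
      Real.sin_pi_div_three]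
    exact hsu
  have hα6 : π/6 ≤ α := by
    rw [hα, ← hs, Real.le_arcsin_iff_sin_le ⟨by linarith [pi_pos], by linarith [pi_pos]⟩ ⟨by linarith, hs1⟩ ,
      Real.sin_pi_div_six]
    exact hsh
  rw [← hα]
  have hpi := pi_pos
  obtain ⟨c, hc⟩ : ∃ c, c = cos α := ⟨_, rfl⟩
  have hcs : s^2 + c^2 = 1 := by rw [← hsin, hc]; exact Real.sin_sq_add_cos_sq α
  have hc0 : 0 ≤ c := by rw [hc]; exact Real.cos_nonneg_of_mem_Icc ⟨by linarith, by linarith⟩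
  have hc1 : c ≤ 1 := by nlinarith
  have hch : 1/2 ≤ c := by nlinarith
  have hsθ : sin (π/3 - α) = √3/2*c - s/2 := by
    rw [Real.sin_sub, Real.sin_pi_div_three, Real.cos_pi_div_three, hsin, ← hc]; ring
  have hsθ2 : sin (2*π/3 - α) = √3/2*c + s/2 := by
    rw [show 2*π/3 - α = π - (π/3 + α) by ring, Real.sin_pi_sub,
      Real.sin_add, Real.sin_pi_div_three, Real.cos_pi_div_three, hsin, ← hc]; ring
  obtain ⟨X, hXd⟩ : ∃ X, X = R₀ * (√3/2*c - s/2) := ⟨_, rfl⟩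
  obtain ⟨Y, hYd⟩ : ∃ Y, Y = R₀ * (√3*s - c)/2 := ⟨_, rfl⟩
  have hX : 0 ≤ X := by
    rw [hXd, ← hsθ]
    exact mul_nonneg hR.le (Real.sin_nonneg_of_nonneg_of_le_pi (by linarith) (by linarith))
  have hY : 0 ≤ Y := by
    have : 0 ≤ √3 * s - c := by nlinarith
    rw [hYd]; positivity
  have hhY : √3/2*l - Y = R₀ * (√3*s + c)/2 := by rw [hYd, hls]; ring
  have hhY0 : 0 ≤ √3/2*l - Y := by rw [hhY]; positivity
  have e1 : (X + l/2)^2 + Y^2 = R₀^2 := by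
    rw [hXd, hYd, hls]
    linear_combination (R₀^2*(s^2+c^2)/4) * s3 + R₀^2 * hcs
  have e2 : X^2 + (√3/2*l - Y)^2 = R₀^2 := by
    rw [hXd, hhY]
    linear_combination (R₀^2*(s^2+c^2)/4) * s3 + R₀^2 * hcs
  rw [tdi_planar l R₀ X Y (√3/2*l) hl hR hX hY (by linarith) hR₀u e1 e2]
  have c1 : Continuous (fun x : ℝ => √(R₀^2 - (x + l/2)^2)) := by fun_prop
  have c2 : Continuous (fun x : ℝ => √(R₀^2 - x^2)) := by fun_prop
  have c12 : Continuous (fun x : ℝ => √(R₀^2 - (x + l/2)^2) + √(R₀^2 - x^2)) := c1.add c2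
  rw [intervalIntegral.integral_sub (c12.intervalIntegrable _ _) (by simp),
    intervalIntegral.integral_add (c1.intervalIntegrable _ _) (c2.intervalIntegrable _ _),
    intervalIntegral.integral_comp_add_right (fun x => √(R₀^2 - x^2)),
    tdi_int R₀ (0 + l/2) (X + l/2) hR (by linarith) (by linarith) (by nlinarith),
    tdi_int R₀ 0 X hR le_rfl hX (by nlinarith), intervalIntegral.integral_const]
  have a1 : arcsin (X / R₀) = π/3 - α := by
    rw [hXd, mul_div_cancel_left₀ _ hR.ne', ← hsθ, Real.arcsin_sin (by linarith) (by linarith)]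
  have a2 : arcsin ((X + l/2) / R₀) = 2*π/3 - α := by
    rw [show (X + l/2) / R₀ = √3/2*c + s/2 by rw [hXd, hls]; field_simp; ring, ← hsθ2,
      Real.arcsin_sin (by linarith) (by linarith)]
  have a3 : arcsin ((0 + l/2) / R₀) = α := by
    rw [hα]; congr 1; field_simp; ring
  have q1 : √(R₀^2 - X^2) = R₀ * (√3*s + c)/2 := by
    rw [← e2, ← hhY, add_sub_cancel_left, Real.sqrt_sq hhY0]
  have q2 : √(R₀^2 - (X + l/2)^2) = R₀ * (√3*s - c)/2 := by
    rw [← e1, ← hYd, add_sub_cancel_left, Real.sqrt_sq hY]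
  have q3 : √(R₀^2 - (0 + l/2)^2) = R₀ * c := by
    rw [show R₀^2 - (0 + l/2)^2 = (R₀*c)^2 by rw [hls]; linear_combination (-R₀^2) * hcs,
      Real.sqrt_sq (by positivity)]
  rw [a1, a2, a3, q1, q2, q3, hsθ]
  simp only [zero_div, Real.arcsin_zero, smul_eq_mul]
  rw [hXd, hls]
  linear_combination (R₀^2*s*c/2) * s3
end

section
/- Let l > 0 and let P₁, P₂, P₃ ∈ ℝ² be the vertices of an equilateral triangle of side length l. Let R₀ satisfy (√3/3)l < R₀ ≤ (√3/2)l and let A = { p ∈ ℝ² : |p − Pᵢ| ≤ R₀ for i = 1, 2, 3 }. Then ∫_A |p − P₁|² |p − P₂|² |p − P₃|² dp = (1/8)[ l⁸/(8√3) + (3√3 + 4π) l⁴R₀⁴ + 8(√3 + π) l²R₀⁶ + 2πR₀⁸ − 6R₀⁴(2l⁴ + 4l²R₀² + R₀⁴) arcsin( l/(2R₀) ) − (1/8) l R₀ √(4 − l²/R₀²) ( l⁶ + 2l⁴R₀² + 102 l²R₀⁴ + 84 R₀⁶ ) ]. -/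
open MeasureTheory Real

noncomputable def momM (R : ℝ) : ℕ → ℝ → ℝ
  | 0, u => (u * √(R ^ 2 - u ^ 2) + R ^ 2 * arcsin (u / R)) / 2
  | 1, u => -(√(R ^ 2 - u ^ 2)) ^ 3 / 3
  | (k + 2), u => ((k + 1) * R ^ 2 * momM R k u - u ^ (k + 1) * (√(R ^ 2 - u ^ 2)) ^ 3) / (k + 4)

lemma sqrt_deriv_aux {R u : ℝ} (h : u ^ 2 < R ^ 2) :
    HasDerivAt (fun u => √(R ^ 2 - u ^ 2)) (-u / √(R ^ 2 - u ^ 2)) u := by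
  have h1 : HasDerivAt (fun u : ℝ => R ^ 2 - u ^ 2) (-(2 * u)) u := by
    simpa using (hasDerivAt_pow 2 u).const_sub (R ^ 2)
  convert h1.sqrt (by linarith) using 1
  field_simp

lemma momM_deriv {R : ℝ} (hR : 0 < R) {u : ℝ} (h : u ^ 2 < R ^ 2) (k : ℕ) :
    HasDerivAt (momM R k) (u ^ k * √(R ^ 2 - u ^ 2)) u := by
  have hs := sqrt_deriv_aux h
  have hpos : 0 < √(R ^ 2 - u ^ 2) := Real.sqrt_pos.mpr (by linarith)
  have hsq : √(R ^ 2 - u ^ 2) ^ 2 = R ^ 2 - u ^ 2 := Real.sq_sqrt (by linarith)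
  have habs := abs_lt_of_sq_lt_sq' h hR.le
  induction k using Nat.twoStepInduction with
  | zero =>
    have h1 : HasDerivAt (fun u => arcsin (u / R)) (1 / √(1 - (u / R) ^ 2) * (1 / R)) u := by
      have h3 : -1 < u / R := by rw [lt_div_iff₀ hR]; linarith
      have h4 : u / R < 1 := by rw [div_lt_iff₀ hR]; linarith
      exact (Real.hasDerivAt_arcsin h3.ne' h4.ne).comp u ((hasDerivAt_id u).div_const R)
    have h2 : √(1 - (u / R) ^ 2) = √(R ^ 2 - u ^ 2) / R := by
      rw [show 1 - (u / R) ^ 2 = (R ^ 2 - u ^ 2) / R ^ 2 by field_simp, Real.sqrt_div (by linarith),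
        Real.sqrt_sq hR.le]
    have := (((hasDerivAt_id u).mul hs).add (h1.const_mul (R ^ 2))).div_const 2
    have e : momM R 0 = fun u => (u * √(R ^ 2 - u ^ 2) + R ^ 2 * arcsin (u / R)) / 2 := by
      funext u; rw [momM]
    rw [e]
    refine this.congr_deriv ?_
    rw [h2]
    generalize √(R ^ 2 - u ^ 2) = s at *
    simp only [id]
    field_simp
    linear_combination -hsq
  | one =>
    have := ((hs.pow 3).neg).div_const 3
    have e : momM R 1 = fun u => -(√(R ^ 2 - u ^ 2)) ^ 3 / 3 := by
      funext u; rw [momM]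
    rw [e]
    refine this.congr_deriv ?_
    generalize √(R ^ 2 - u ^ 2) = s at *
    field_simp
    norm_num
    ring
  | more k ih1 ih2 =>
    have := ((ih1.const_mul ((k + 1) * R ^ 2)).sub ((hasDerivAt_pow (k + 1) u).mul (hs.pow 3))).div_const
      ((k : ℝ) + 4)
    have e : momM R (k + 2) = fun u => ((k + 1) * R ^ 2 * momM R k u
        - u ^ (k + 1) * (√(R ^ 2 - u ^ 2)) ^ 3) / (k + 4) := by
      funext u; rw [momM]
    rw [e]
    refine this.congr_deriv ?_
    simp only [Pi.pow_apply]
    generalize √(R ^ 2 - u ^ 2) = s at *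
    have : (k : ℝ) + 4 ≠ 0 := by positivity
    push_cast
    field_simp
    have : s ^ 2 = R ^ 2 - u ^ 2 := hsq
    linear_combination (-(k + 1) * u ^ k) * hsq

lemma momM_sum_deriv {R : ℝ} (hR : 0 < R) (b : ℝ) {x : ℝ} (h : (x + b) ^ 2 < R ^ 2) (k : ℕ) :
    HasDerivAt (fun x => momM R k (x + b)) ((x + b) ^ k * √(R ^ 2 - (x + b) ^ 2)) x := by
  have := (momM_deriv hR h k).comp_add_const x b
  exact this

/-- polynomial integrand -/
def fpol (w a x y : ℝ) : ℝ :=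
  ((x + a) ^ 2 + y ^ 2) * ((x - a) ^ 2 + y ^ 2) * (x ^ 2 + (y - w * a) ^ 2)

noncomputable def Qpol (w a x y : ℝ) : ℝ :=
  3*y*a^6 - y^2*a^5*w + (7/3)*y^3*a^4 - y^4*a^3*w + y^5*a^2 - (1/3)*y^6*a*w + (1/7)*y^7
   - 5*x^2*y*a^4 + 2*x^2*y^2*a^3*w + 2*x^2*y^3*a^2 - x^2*y^4*a*w + (3/5)*x^2*y^5
   + x^4*y*a^2 - x^4*y^2*a*w + x^4*y^3 + x^6*y

lemma Qpol_deriv {w : ℝ} (hw : w ^ 2 = 3) (a x y : ℝ) :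
    HasDerivAt (fun y => Qpol w a x y) (fpol w a x y) y := by
  have hp := fun n : ℕ => hasDerivAt_pow n y
  have h0 := hasDerivAt_id' y
  have := (((((((h0.mul_const (3*a^6 - 5*x^2*a^4 + x^4*a^2 + x^6)).add
    ((hp 2).mul_const (-a^5*w + 2*x^2*a^3*w - x^4*a*w))).add
    ((hp 3).mul_const ((7/3)*a^4 + 2*x^2*a^2 + x^4))).add
    ((hp 4).mul_const (-a^3*w - x^2*a*w))).add
    ((hp 5).mul_const (a^2 + (3/5)*x^2))).add
    ((hp 6).mul_const (-(1/3)*a*w))).add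
    ((hp 7).mul_const (1/7)))
  convert! this using 1
  · funext y
    simp only [Qpol, Pi.add_apply]
    ring
  · simp only [fpol]
    norm_num
    linear_combination (a^2 * ((x + a) ^ 2 + y ^ 2) * ((x - a) ^ 2 + y ^ 2)) * hw

lemma inner_int {w : ℝ} (hw : w ^ 2 = 3) (a x p q : ℝ) :
    ∫ y in p..q, fpol w a x y = Qpol w a x q - Qpol w a x p := by
  apply intervalIntegral.integral_eq_sub_of_hasDerivAt (fun y _ => Qpol_deriv hw a x y)
  apply Continuous.intervalIntegrable
  unfold fpol
  fun_prop

noncomputable def Gpol (w a R x : ℝ) : ℝ :=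
  ((1/7)*(R^2)^3 + (8/5)*a^2*(R^2)^2 + (16/3)*a^4*R^2) * momM R 0 (x + a)
  + (-(6/5)*a*(R^2)^2 - 8*a^3*R^2) * momM R 1 (x + a)
  + ((6/35)*(R^2)^2 + (24/5)*a^2*R^2 + (32/3)*a^4) * momM R 2 (x + a)
  + (-(8/5)*a*R^2 - 16*a^3) * momM R 3 (x + a)
  + ((8/35)*R^2 + (48/5)*a^2) * momM R 4 (x + a)
  + (-(16/5)*a) * momM R 5 (x + a)
  + (16/35) * momM R 6 (x + a)
  + ((-(1/3)*a*(R^2)^3*w - 2*a^3*(R^2)^2*w) * (x + a) + 2*a^2*(R^2)^2*w * ((x + a)^2/2)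
     + 2*a^3*w*((x + a)^5/5) - 2*a^2*w*((x + a)^6/6) + (1/3)*a*w*((x + a)^7/7))
  + ((1/7)*(R^2)^3 + 4*a^2*(R^2)^2 + (16/3)*a^4*R^2) * momM R 0 (x + 0)
  + ((6/35)*(R^2)^2 + (32/3)*a^4) * momM R 2 (x + 0)
  + (8/35)*R^2 * momM R 4 (x + 0)
  + (16/35) * momM R 6 (x + 0)
  - (((2/3)*a*(R^2)^3*w + 4*a^3*(R^2)^2*w + (13/7)*a^7*w) * x + (17/5)*a^5*w*(x^3/3)
     - 3*a^3*w*(x^5/5) + (1/3)*a*w*(x^7/7))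

lemma pw_deriv (b x : ℝ) (n : ℕ) :
    HasDerivAt (fun x : ℝ => (x + b) ^ (n + 1) / (n + 1 : ℝ)) ((x + b) ^ n) x := by
  have := (((hasDerivAt_id' x).add_const b).pow (n + 1)).div_const (n + 1 : ℝ)
  refine this.congr_deriv ?_
  have : (n : ℝ) + 1 ≠ 0 := by positivity
  push_cast
  field_simp

lemma Gpol_deriv {w a R x : ℝ} (hw : w ^ 2 = 3) (hR : 0 < R) (h1 : (x + a) ^ 2 < R ^ 2)
    (h0 : x ^ 2 < R ^ 2) :
    HasDerivAt (Gpol w a R) (Qpol w a x (√(R ^ 2 - (x + a) ^ 2))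
      - Qpol w a x (w * a - √(R ^ 2 - x ^ 2))) x := by
  have m1 := momM_sum_deriv hR a h1
  have m0 := momM_sum_deriv hR 0 (x := x) (by simpa using h0)
  have p1 := pw_deriv a x
  have p0 := pw_deriv 0 x
  have := ((((((((((((((((((((((m1 0).const_mul ((1/7)*(R^2)^3 + (8/5)*a^2*(R^2)^2 + (16/3)*a^4*R^2)).add
    ((m1 1).const_mul (-(6/5)*a*(R^2)^2 - 8*a^3*R^2))).add
    ((m1 2).const_mul ((6/35)*(R^2)^2 + (24/5)*a^2*R^2 + (32/3)*a^4))).add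
    ((m1 3).const_mul (-(8/5)*a*R^2 - 16*a^3))).add
    ((m1 4).const_mul ((8/35)*R^2 + (48/5)*a^2))).add
    ((m1 5).const_mul (-(16/5)*a))).add
    ((m1 6).const_mul (16/35))).add
    ((p1 0).const_mul (-(1/3)*a*(R^2)^3*w - 2*a^3*(R^2)^2*w))).add
    ((p1 1).const_mul (2*a^2*(R^2)^2*w))).add
    ((p1 4).const_mul (2*a^3*w))).sub
    ((p1 5).const_mul (2*a^2*w))).add
    ((p1 6).const_mul ((1/3)*a*w))).add
    ((m0 0).const_mul ((1/7)*(R^2)^3 + 4*a^2*(R^2)^2 + (16/3)*a^4*R^2))).add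
    ((m0 2).const_mul ((6/35)*(R^2)^2 + (32/3)*a^4))).add
    ((m0 4).const_mul ((8/35)*R^2))).add
    ((m0 6).const_mul (16/35))).sub
    ((p0 0).const_mul ((2/3)*a*(R^2)^3*w + 4*a^3*(R^2)^2*w + (13/7)*a^7*w))).sub
    ((p0 2).const_mul ((17/5)*a^5*w))).add
    ((p0 4).const_mul (3*a^3*w))).sub
    ((p0 6).const_mul ((1/3)*a*w))))
  convert! this using 1
  · funext y
    simp only [Gpol, Pi.add_apply, Pi.sub_apply]
    push_cast
    ring
  · have e1 : √(R ^ 2 - (x + a) ^ 2) ^ 2 = R ^ 2 - (x + a) ^ 2 := Real.sq_sqrt (by linarith)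
    have e0 : √(R ^ 2 - x ^ 2) ^ 2 = R ^ 2 - x ^ 2 := Real.sq_sqrt (by linarith)
    simp only [add_zero]
    generalize √(R ^ 2 - (x + a) ^ 2) = s at *
    generalize √(R ^ 2 - x ^ 2) = t at *
    clear this m1 m0 p1 p0
    have q1 : Qpol w a x s = s * (3*a^6 + (7/3)*s^2*a^4 + (s^2)^2*a^2 + (1/7)*(s^2)^3
        - 5*x^2*a^4 + 2*x^2*s^2*a^2 + (3/5)*x^2*(s^2)^2 + x^4*a^2 + x^4*s^2 + x^6)
        + w * (- s^2*a^5 - (s^2)^2*a^3 - (1/3)*(s^2)^3*a + 2*x^2*s^2*a^3 - x^2*(s^2)^2*a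
          - x^4*s^2*a) := by
      unfold Qpol; ring
    rw [q1, e1]
    have w3 : w ^ 3 = 3 * w := by linear_combination w * hw
    have w4 : w ^ 4 = 9 := by linear_combination (w ^ 2 + 3) * hw
    have w5 : w ^ 5 = 9 * w := by linear_combination (w ^ 3 + 3 * w) * hw
    have w6 : w ^ 6 = 27 := by linear_combination (w ^ 4 + 3 * w ^ 2 + 9) * hw
    have w7 : w ^ 7 = 27 * w := by linear_combination (w ^ 5 + 3 * w ^ 3 + 9 * w) * hw
    have t3 : t ^ 3 = (R ^ 2 - x ^ 2) * t := by rw [← e0]; ring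
    have t4 : t ^ 4 = (R ^ 2 - x ^ 2) ^ 2 := by rw [← e0]; ring
    have t5 : t ^ 5 = (R ^ 2 - x ^ 2) ^ 2 * t := by rw [← e0]; ring
    have t6 : t ^ 6 = (R ^ 2 - x ^ 2) ^ 3 := by rw [← e0]; ring
    have t7 : t ^ 7 = (R ^ 2 - x ^ 2) ^ 3 * t := by rw [← e0]; ring
    unfold Qpol
    ring_nf
    simp only [hw, w3, w4, w5, w6, w7, e0, t3, t4, t5, t6, t7]
    ring_nf

lemma final_alg {w a c R θ : ℝ} (hw : w ^ 2 = 3)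
    (hRc : R ^ 2 = a ^ 2 + c ^ 2)
    (s1 : √(R ^ 2 - ((w * c - a) / 2 + a) ^ 2) = (w * a - c) / 2)
    (s0 : √(R ^ 2 - ((w * c - a) / 2) ^ 2) = (w * a + c) / 2)
    (s2 : √(R ^ 2 - a ^ 2) = c)
    (t1 : arcsin (((w * c - a) / 2 + a) / R) = 2 * π / 3 - θ)
    (t0 : arcsin (((w * c - a) / 2) / R) = π / 3 - θ)
    (t2 : arcsin (a / R) = θ) :
    2 * (Gpol w a R ((w * c - a) / 2) - Gpol w a R 0) =
      (1 / 8) * ((2 * a) ^ 8 * w / 24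
          + (3 * w + 4 * π) * (2 * a) ^ 4 * (R ^ 2) ^ 2
          + 8 * (w + π) * (2 * a) ^ 2 * (R ^ 2) ^ 3
          + 2 * π * (R ^ 2) ^ 4
          - 6 * (R ^ 2) ^ 2 * (2 * (2 * a) ^ 4 + 4 * (2 * a) ^ 2 * R ^ 2 + (R ^ 2) ^ 2) * θ
          - (1 / 8) * (2 * a) * (2 * c)
              * ((2 * a) ^ 6 + 2 * (2 * a) ^ 4 * R ^ 2 + 102 * (2 * a) ^ 2 * (R ^ 2) ^ 2
                + 84 * (R ^ 2) ^ 3)) := by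
  have w3 : w ^ 3 = 3 * w := by linear_combination w * hw
  have w4 : w ^ 4 = 9 := by linear_combination (w ^ 2 + 3) * hw
  have w5 : w ^ 5 = 9 * w := by linear_combination (w ^ 3 + 3 * w) * hw
  have w6 : w ^ 6 = 27 := by linear_combination (w ^ 4 + 3 * w ^ 2 + 9) * hw
  have w7 : w ^ 7 = 27 * w := by linear_combination (w ^ 5 + 3 * w ^ 3 + 9 * w) * hw
  have w8 : w ^ 8 = 81 := by linear_combination (w ^ 6 + 3 * w ^ 4 + 9 * w ^ 2 + 27) * hw
  simp only [Gpol, momM, add_zero, zero_add, s1, s0, s2, t1, t0, t2, zero_div, arcsin_zero]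
  simp only [hRc]
  push_cast
  ring_nf
  simp only [hw, w3, w4, w5, w6, w7, w8]
  ring_nf

def regB (w a R : ℝ) : Set (ℝ × ℝ) :=
  {p | (p.1 + a) ^ 2 + p.2 ^ 2 ≤ R ^ 2 ∧ (p.1 - a) ^ 2 + p.2 ^ 2 ≤ R ^ 2 ∧
    p.1 ^ 2 + (p.2 - w * a) ^ 2 ≤ R ^ 2}

lemma regB_compact (w a R : ℝ) (hR : 0 < R) : IsCompact (regB w a R) := by
  refine (isCompact_Icc (a := ((-R - a, -R) : ℝ × ℝ)) (b := (R - a, R))).of_isClosed_subset ?_ ?_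
  · have c1 : IsClosed {p : ℝ × ℝ | (p.1 + a) ^ 2 + p.2 ^ 2 ≤ R ^ 2} :=
      isClosed_le (by fun_prop) (by fun_prop)
    have c2 : IsClosed {p : ℝ × ℝ | (p.1 - a) ^ 2 + p.2 ^ 2 ≤ R ^ 2} :=
      isClosed_le (by fun_prop) (by fun_prop)
    have c3 : IsClosed {p : ℝ × ℝ | p.1 ^ 2 + (p.2 - w * a) ^ 2 ≤ R ^ 2} :=
      isClosed_le (by fun_prop) (by fun_prop)
    exact c1.inter (c2.inter c3)
  · rintro ⟨x, y⟩ ⟨h1, -, -⟩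
    simp only at h1
    have h2 := abs_le_of_sq_le_sq' (a := x + a) (b := R) (by nlinarith [sq_nonneg y]) hR.le
    have h3 := abs_le_of_sq_le_sq' (a := y) (b := R) (by nlinarith [sq_nonneg (x + a)]) hR.le
    simp only [Set.mem_Icc, Prod.mk_le_mk]
    refine ⟨⟨by linarith, by linarith⟩, by linarith, by linarith⟩

lemma slice_empty {w a c R x y : ℝ} (hw : w ^ 2 = 3) (hw0 : 0 < w) (ha : 0 < a) (hc : 0 < c)
    (hRc : R ^ 2 = a ^ 2 + c ^ 2) (hc1 : a < w * c) (hc2 : c < w * a)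
    (h : (x, y) ∈ regB w a R) : x ≤ (w * c - a) / 2 := by
  obtain ⟨h1, -, h3⟩ := h
  simp only at h1 h3
  by_contra hx
  push Not at hx
  set X := (w * c - a) / 2 with hX
  set Y := (w * a - c) / 2 with hY
  have e1 : (X + a) ^ 2 + Y ^ 2 = R ^ 2 := by
    rw [hRc, hX, hY]; linear_combination ((c ^ 2 + a ^ 2) / 4) * hw
  have e3 : X ^ 2 + (Y - w * a) ^ 2 = R ^ 2 := by
    rw [hRc, hX, hY]; linear_combination ((c ^ 2 + a ^ 2) / 4) * hw
  have i1 : (x - X) * (X + a) + (y - Y) * Y ≤ 0 := by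
    nlinarith [sq_nonneg (x - X), sq_nonneg (y - Y)]
  have i3 : (x - X) * X + (y - Y) * (Y - w * a) ≤ 0 := by
    nlinarith [sq_nonneg (x - X), sq_nonneg (y - Y)]
  have hX0 : 0 < X := by rw [hX]; linarith
  have hY0 : 0 < Y := by rw [hY]; linarith
  have hY1 : 0 < w * a - Y := by rw [hY]; nlinarith
  have k1 := mul_nonpos_of_nonpos_of_nonneg i1 hY1.le
  have k2 := mul_nonpos_of_nonpos_of_nonneg i3 hY0.le
  have k3 : 0 < (x - X) * ((X + a) * (w * a - Y) + X * Y) := by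
    apply mul_pos (by linarith)
    positivity
  nlinarith

lemma slice_eq {w a c R x : ℝ} (hw : w ^ 2 = 3) (hw0 : 0 < w) (ha : 0 < a) (hc : 0 < c)
    (hR : 0 < R)
    (hRc : R ^ 2 = a ^ 2 + c ^ 2) (hc1 : a < w * c) (hc2 : c < w * a) (hRw : R ≤ w * a)
    (hx0 : 0 < x) (hx1 : x ≤ (w * c - a) / 2) :
    (w * a - √(R ^ 2 - x ^ 2) ≤ √(R ^ 2 - (x + a) ^ 2)) ∧
    ∀ y, (x, y) ∈ regB w a R ↔ y ∈ Set.Icc (w * a - √(R ^ 2 - x ^ 2)) (√(R ^ 2 - (x + a) ^ 2)) := by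
  set X := (w * c - a) / 2 with hX
  set Y := (w * a - c) / 2 with hY
  have e1 : (X + a) ^ 2 + Y ^ 2 = R ^ 2 := by
    rw [hRc, hX, hY]; linear_combination ((c ^ 2 + a ^ 2) / 4) * hw
  have e3 : X ^ 2 + (Y - w * a) ^ 2 = R ^ 2 := by
    rw [hRc, hX, hY]; linear_combination ((c ^ 2 + a ^ 2) / 4) * hw
  have hY0 : 0 < Y := by rw [hY]; linarith
  have hY1 : 0 < w * a - Y := by rw [hY]; nlinarith
  have hs : Y ≤ √(R ^ 2 - (x + a) ^ 2) := by
    apply Real.le_sqrt_of_sq_le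
    nlinarith
  have ht : w * a - Y ≤ √(R ^ 2 - x ^ 2) := by
    apply Real.le_sqrt_of_sq_le
    nlinarith
  have hsq : √(R ^ 2 - (x + a) ^ 2) ^ 2 = R ^ 2 - (x + a) ^ 2 := Real.sq_sqrt (by nlinarith)
  have htq : √(R ^ 2 - x ^ 2) ^ 2 = R ^ 2 - x ^ 2 := Real.sq_sqrt (by nlinarith)
  have hsR : √(R ^ 2 - (x + a) ^ 2) ≤ R := by
    apply Real.sqrt_le_iff.mpr ⟨hR.le, by nlinarith [sq_nonneg (x + a)]⟩
  have htR : √(R ^ 2 - x ^ 2) ≤ R := by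
    apply Real.sqrt_le_iff.mpr ⟨hR.le, by nlinarith [sq_nonneg x]⟩
  refine ⟨by linarith, fun y => ?_⟩
  simp only [regB, Set.mem_ofPred_eq, Set.mem_Icc]
  generalize √(R ^ 2 - (x + a) ^ 2) = s at *
  generalize √(R ^ 2 - x ^ 2) = t at *
  constructor
  · rintro ⟨h1, -, h3⟩
    have := abs_le_of_sq_le_sq' (a := y) (b := s) (by linarith) (by linarith)
    have := abs_le_of_sq_le_sq' (a := y - w * a) (b := t) (by linarith) (by linarith)
    constructor <;> linarith
  · rintro ⟨h1, h2⟩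
    have hy0 : 0 ≤ y := by linarith
    have g1 : y ^ 2 ≤ s ^ 2 := by gcongr
    have g2 : (w * a - y) ^ 2 ≤ t ^ 2 := by
      have : 0 ≤ w * a - y := by linarith
      gcongr; linarith
    refine ⟨by linarith, by nlinarith, by nlinarith⟩

lemma std_integral {w a c R : ℝ} (hw : w ^ 2 = 3) (hw0 : 0 < w) (ha : 0 < a) (hc : 0 < c)
    (hR : 0 < R)
    (hRc : R ^ 2 = a ^ 2 + c ^ 2) (hc1 : a < w * c) (hc2 : c < w * a) (hRw : R ≤ w * a) :
    ∫ p in regB w a R, fpol w a p.1 p.2 =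
      2 * (Gpol w a R ((w * c - a) / 2) - Gpol w a R 0) := by
  have hcomp := regB_compact w a R hR
  have hmeas := hcomp.measurableSet
  have hcont : Continuous (fun p : ℝ × ℝ => fpol w a p.1 p.2) := by unfold fpol; fun_prop
  have hint : Integrable ((regB w a R).indicator (fun p : ℝ × ℝ => fpol w a p.1 p.2))
      (volume.prod volume) := by
    rw [← Measure.volume_eq_prod, integrable_indicator_iff hmeas]
    exact hcont.continuousOn.integrableOn_compact hcomp
  rw [← integral_indicator hmeas, Measure.volume_eq_prod, integral_prod _ hint]
  set g : ℝ → ℝ := fun x => ∫ y, (regB w a R).indicator (fun p : ℝ × ℝ => fpol w a p.1 p.2) (x, y)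
    with hg
  have heven : ∀ x, g (-x) = g x := by
    intro x
    simp only [hg]
    congr 1
    funext y
    have h1 : fpol w a (-x) y = fpol w a x y := by unfold fpol; ring
    have h2 : (-x, y) ∈ regB w a R ↔ (x, y) ∈ regB w a R := by
      simp only [regB, Set.mem_ofPred_eq]
      rw [show (-x + a) ^ 2 = (x - a) ^ 2 by ring, show (-x - a) ^ 2 = (x + a) ^ 2 by ring,
        neg_sq]
      tauto
    by_cases h : (x, y) ∈ regB w a R
    · rw [Set.indicator_of_mem h, Set.indicator_of_mem (h2.mpr h), h1]
    · rw [Set.indicator_of_notMem h, Set.indicator_of_notMem (fun h' => h (h2.mp h'))]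
  have habs : ∀ x, g x = g |x| := by
    intro x
    rcases abs_choice x with h | h <;> rw [h]
    exact (heven x).symm
  have hX0 : 0 < (w * c - a) / 2 := by linarith
  have step1 : ∫ x, g x = 2 * ∫ x in Set.Ioi 0, g x := by
    rw [← integral_comp_abs]
    exact integral_congr_ae (Filter.Eventually.of_forall habs)
  rw [step1]
  congr 1
  have step2 : ∫ x in Set.Ioi 0, g x = ∫ x in Set.Ioc 0 ((w * c - a) / 2), g x := by
    apply setIntegral_eq_of_subset_of_forall_sdiff_eq_zero measurableSet_Ioi
      (fun x hx => hx.1)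
    intro x hx
    have hx1 : (w * c - a) / 2 < x := by
      by_contra h
      exact hx.2 ⟨hx.1, not_lt.mp h⟩
    simp only [hg]
    have : ∀ y, (regB w a R).indicator (fun p : ℝ × ℝ => fpol w a p.1 p.2) (x, y) = 0 := by
      intro y
      apply Set.indicator_of_notMem
      intro h
      exact absurd (slice_empty hw hw0 ha hc hRc hc1 hc2 h) (not_le.mpr hx1)
    simp [this]
  have step3 : ∀ x ∈ Set.Ioc 0 ((w * c - a) / 2), g x =
      Qpol w a x (√(R ^ 2 - (x + a) ^ 2)) - Qpol w a x (w * a - √(R ^ 2 - x ^ 2)) := by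
    intro x hx
    obtain ⟨hle, hiff⟩ := slice_eq hw hw0 ha hc hR hRc hc1 hc2 hRw hx.1 hx.2
    rw [← inner_int hw, intervalIntegral.integral_of_le hle, ← integral_Icc_eq_integral_Ioc,
      ← integral_indicator measurableSet_Icc]
    simp only [hg]
    congr 1
    funext y
    by_cases h : (x, y) ∈ regB w a R
    · rw [Set.indicator_of_mem h, Set.indicator_of_mem ((hiff y).mp h)]
    · rw [Set.indicator_of_notMem h, Set.indicator_of_notMem (fun h' => h ((hiff y).mpr h'))]
  rw [step2, setIntegral_congr_fun measurableSet_Ioc step3,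
    ← intervalIntegral.integral_of_le hX0.le]
  apply intervalIntegral.integral_eq_sub_of_hasDerivAt
  · intro x hx
    rw [Set.uIcc_of_le hX0.le] at hx
    have e1 : ((w * c - a) / 2 + a) ^ 2 + ((w * a - c) / 2) ^ 2 = R ^ 2 := by
      rw [hRc]; linear_combination ((c ^ 2 + a ^ 2) / 4) * hw
    have hY : 0 < ((w * a - c) / 2) ^ 2 := pow_pos (by linarith) 2
    have h1 : (x + a) ^ 2 < R ^ 2 := by nlinarith [hx.1, hx.2]
    exact Gpol_deriv hw hR h1 (by nlinarith [hx.1])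
  · apply Continuous.intervalIntegrable
    unfold Qpol
    fun_prop

lemma exists_coords {l w : ℝ} (hl : 0 < l) (hw : w ^ 2 = 3) (hw0 : 0 < w)
    (P₁ P₂ P₃ : EuclideanSpace ℝ (Fin 2))
    (h12 : dist P₁ P₂ = l) (h13 : dist P₁ P₃ = l) (h23 : dist P₂ P₃ = l) :
    ∃ φ : (ℝ × ℝ) ≃ᵐ EuclideanSpace ℝ (Fin 2), MeasurePreserving φ volume volume ∧
      ∀ p : ℝ × ℝ, dist (φ p) P₁ ^ 2 = (p.1 + l / 2) ^ 2 + p.2 ^ 2 ∧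
        dist (φ p) P₂ ^ 2 = (p.1 - l / 2) ^ 2 + p.2 ^ 2 ∧
        dist (φ p) P₃ ^ 2 = p.1 ^ 2 + (p.2 - w * (l / 2)) ^ 2 := by
  obtain ⟨v, hv⟩ : ∃ v, v = P₂ - P₁ := ⟨_, rfl⟩
  obtain ⟨u, hu⟩ : ∃ u, u = P₃ - P₁ := ⟨_, rfl⟩
  have nv : ‖v‖ = l := by rw [hv, ← dist_eq_norm, dist_comm, h12]
  have nu : ‖u‖ = l := by rw [hu, ← dist_eq_norm, dist_comm, h13]
  have nvu : ‖v - u‖ = l := by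
    rw [hv, hu, sub_sub_sub_cancel_right, ← dist_eq_norm, h23]
  have ivu : inner ℝ v u = l ^ 2 / 2 := by
    have := norm_sub_sq_real v u
    rw [nv, nu, nvu] at this
    linarith
  have ivv : inner ℝ v v = l ^ 2 := by rw [real_inner_self_eq_norm_sq, nv]
  have iuu : inner ℝ u u = l ^ 2 := by rw [real_inner_self_eq_norm_sq, nu]
  have iuv : inner ℝ u v = l ^ 2 / 2 := by rw [real_inner_comm, ivu]
  obtain ⟨e1, he1⟩ : ∃ e1, e1 = (1 / l) • v := ⟨_, rfl⟩
  obtain ⟨e2, he2⟩ : ∃ e2, e2 = (1 / (w * l)) • ((2 : ℝ) • u - v) := ⟨_, rfl⟩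
  have i11 : inner ℝ e1 e1 = (1 : ℝ) := by
    simp only [he1, inner_smul_left, inner_smul_right, ivv]
    simp
    field_simp
  have i12 : inner ℝ e1 e2 = (0 : ℝ) := by
    simp only [he1, he2, inner_smul_left, inner_smul_right, inner_sub_right, ivv, ivu]
    simp
    right
    ring
  have i22 : inner ℝ e2 e2 = (1 : ℝ) := by
    simp only [he2, inner_smul_left, inner_smul_right, inner_sub_right, inner_sub_left, ivv, ivu,
      iuu, iuv]
    simp
    field_simp
    linarith
  have i21 : inner ℝ e2 e1 = (0 : ℝ) := by rw [real_inner_comm, i12]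
  have hon : Orthonormal ℝ ![e1, e2] := by
    rw [orthonormal_iff_ite]
    intro i j
    fin_cases i <;> fin_cases j <;> simp [i11, i12, i21, i22]
    · have := i11
      rw [real_inner_self_eq_norm_sq] at this
      exact Or.inl <| (pow_eq_one_iff_of_nonneg (norm_nonneg _) two_ne_zero).mp this
    · have := i22
      rw [real_inner_self_eq_norm_sq] at this
      exact Or.inl <| (pow_eq_one_iff_of_nonneg (norm_nonneg _) two_ne_zero).mp this
  let b0 := basisOfOrthonormalOfCardEqFinrank hon (by simp)
  have hb0 : ⇑b0 = ![e1, e2] := coe_basisOfOrthonormalOfCardEqFinrank hon (by simp)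
  let b : OrthonormalBasis (Fin 2) ℝ (EuclideanSpace ℝ (Fin 2)) :=
    b0.toOrthonormalBasis (by rw [hb0]; exact hon)
  have hb : ⇑b = ![e1, e2] := by
    simp [b, hb0]
  let M := P₁ + (l / 2) • e1
  let φ : (ℝ × ℝ) ≃ᵐ EuclideanSpace ℝ (Fin 2) :=
    ((MeasurableEquiv.finTwoArrow.symm.trans (MeasurableEquiv.toLp 2 (Fin 2 → ℝ))).trans
      b.measurableEquiv.symm).trans (MeasurableEquiv.addLeft M)
  have hφ : MeasurePreserving φ volume volume := by
    have m1 : MeasurePreserving (MeasurableEquiv.finTwoArrow (α := ℝ)).symm volume volume :=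
      (volume_preserving_finTwoArrow ℝ).symm
    have m2 : MeasurePreserving (MeasurableEquiv.toLp 2 (Fin 2 → ℝ)) volume volume :=
      (EuclideanSpace.volume_preserving_symm_measurableEquiv_toLp (Fin 2)).symm
    have m3 : MeasurePreserving b.measurableEquiv.symm volume volume :=
      b.measurePreserving_measurableEquiv.symm
    have m4 : MeasurePreserving (MeasurableEquiv.addLeft M) volume volume :=
      measurePreserving_add_left volume M
    exact ((m1.trans m2).trans m3).trans m4
  have happ : ∀ p : ℝ × ℝ, φ p = M + (p.1 • e1 + p.2 • e2) := by
    intro p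
    have : φ p = M + b.repr.symm (WithLp.toLp 2 ![p.1, p.2]) := rfl
    rw [this, ← b.sum_repr_symm]
    simp [hb, Fin.sum_univ_two]
  have hnorm : ∀ s t : ℝ, ‖s • e1 + t • e2‖ ^ 2 = s ^ 2 + t ^ 2 := by
    intro s t
    rw [← real_inner_self_eq_norm_sq]
    simp only [inner_add_left, inner_add_right, inner_smul_left, inner_smul_right, i11, i12, i21,
      i22]
    simp
    ring
  have hv1 : P₂ = P₁ + l • e1 := by
    rw [he1, smul_smul, mul_one_div_cancel hl.ne', one_smul, hv]; abel
  have hu1 : P₃ = P₁ + ((l / 2) • e1 + (w * (l / 2)) • e2) := by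
    have : (l / 2) • e1 + (w * (l / 2)) • e2 = u := by
      rw [he1, he2, smul_smul, smul_smul, show l / 2 * (1 / l) = 1 / 2 by field_simp,
        show w * (l / 2) * (1 / (w * l)) = 1 / 2 by field_simp]
      module
    rw [this, hu]; abel
  refine ⟨φ, hφ, fun p => ?_⟩
  rw [happ]
  refine ⟨?_, ?_, ?_⟩
  · rw [dist_eq_norm, ← hnorm]
    congr 2
    simp only [M]
    module
  · rw [dist_eq_norm, ← hnorm, hv1]
    congr 2
    simp only [M]
    module
  · rw [dist_eq_norm, ← hnorm, hu1]
    congr 2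
    simp only [M]
    module

/-- Equation (13) in Lemma 1 (before dividing by the area `S_A`): exact evaluation of
`∫_A |p−P₁|² |p−P₂|² |p−P₃|² dp` over the intersection `A` of the three discs of radius `R₀`
centered at the vertices of an equilateral triangle of side length `l`. -/
theorem integral_product_squared_distances
    (l R₀ : ℝ) (hl : 0 < l)
    (P₁ P₂ P₃ : EuclideanSpace ℝ (Fin 2))
    (h12 : dist P₁ P₂ = l) (h13 : dist P₁ P₃ = l) (h23 : dist P₂ P₃ = l)
    (hR₀l : Real.sqrt 3 / 3 * l < R₀) (hR₀u : R₀ ≤ Real.sqrt 3 / 2 * l) :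
    (∫ p in {p : EuclideanSpace ℝ (Fin 2) |
        dist p P₁ ≤ R₀ ∧ dist p P₂ ≤ R₀ ∧ dist p P₃ ≤ R₀},
      dist p P₁ ^ 2 * dist p P₂ ^ 2 * dist p P₃ ^ 2)
      = (1 / 8) * (l ^ 8 / (8 * Real.sqrt 3)
          + (3 * Real.sqrt 3 + 4 * π) * l ^ 4 * R₀ ^ 4
          + 8 * (Real.sqrt 3 + π) * l ^ 2 * R₀ ^ 6
          + 2 * π * R₀ ^ 8
          - 6 * R₀ ^ 4 * (2 * l ^ 4 + 4 * l ^ 2 * R₀ ^ 2 + R₀ ^ 4)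
              * Real.arcsin (l / (2 * R₀))
          - (1 / 8) * l * R₀ * Real.sqrt (4 - l ^ 2 / R₀ ^ 2)
              * (l ^ 6 + 2 * l ^ 4 * R₀ ^ 2 + 102 * l ^ 2 * R₀ ^ 4 + 84 * R₀ ^ 6)) := by
  obtain ⟨w, hwdef⟩ : ∃ w, w = √3 := ⟨_, rfl⟩
  obtain ⟨a, hadef⟩ : ∃ a, a = l / 2 := ⟨_, rfl⟩
  have hla : l = 2 * a := by linarith
  have ha : 0 < a := by linarith
  have hw : w ^ 2 = 3 := by rw [hwdef]; exact Real.sq_sqrt (by norm_num)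
  have hw0 : 0 < w := by rw [hwdef]; positivity
  rw [← hwdef] at hR₀l hR₀u ⊢
  have hR : 0 < R₀ := lt_of_le_of_lt (by positivity) hR₀l
  have hRw : R₀ ≤ w * a := by rw [hadef]; linarith
  have hRl2 : 4 * a ^ 2 < 3 * R₀ ^ 2 := by
    have h1 : (w / 3 * l) ^ 2 < R₀ ^ 2 := by gcongr
    have h2 : (w / 3 * l) ^ 2 = 4 * a ^ 2 / 3 := by
      rw [hla]; linear_combination (4 * a ^ 2 / 9) * hw
    linarith
  have hRu2 : R₀ ^ 2 ≤ 3 * a ^ 2 := by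
    have h1 : R₀ ^ 2 ≤ (w * a) ^ 2 := by gcongr
    rwa [mul_pow, hw] at h1
  have ha2 : 0 < a ^ 2 := by positivity
  obtain ⟨c, hcdef⟩ : ∃ c, c = √(R₀ ^ 2 - a ^ 2) := ⟨_, rfl⟩
  have hc : 0 < c := by rw [hcdef]; exact Real.sqrt_pos.mpr (by linarith)
  have hc2 : c ^ 2 = R₀ ^ 2 - a ^ 2 := by rw [hcdef]; exact Real.sq_sqrt (by linarith)
  have hRc : R₀ ^ 2 = a ^ 2 + c ^ 2 := by linarith
  have hc1 : a < w * c := by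
    apply lt_of_pow_lt_pow_left₀ 2 (by positivity)
    rw [mul_pow, hw]; linarith
  have hcw : c < w * a := by
    apply lt_of_pow_lt_pow_left₀ 2 (by positivity)
    rw [mul_pow, hw]; linarith
  obtain ⟨φ, hφ, hd⟩ := exists_coords hl hw hw0 P₁ P₂ P₃ h12 h13 h23
  rw [← hφ.setIntegral_preimage_emb φ.measurableEmbedding]
  have hset : φ ⁻¹' {p : EuclideanSpace ℝ (Fin 2) |
        dist p P₁ ≤ R₀ ∧ dist p P₂ ≤ R₀ ∧ dist p P₃ ≤ R₀} = regB w a R₀ := by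
    ext p
    obtain ⟨d1, d2, d3⟩ := hd p
    rw [← hadef] at d1 d2 d3
    simp only [Set.mem_preimage, Set.mem_ofPred_eq, regB, ← d1, ← d2, ← d3]
    rw [sq_le_sq₀ dist_nonneg hR.le, sq_le_sq₀ dist_nonneg hR.le, sq_le_sq₀ dist_nonneg hR.le]
  have hfun : ∀ p : ℝ × ℝ, dist (φ p) P₁ ^ 2 * dist (φ p) P₂ ^ 2 * dist (φ p) P₃ ^ 2
      = fpol w a p.1 p.2 := by
    intro p
    obtain ⟨d1, d2, d3⟩ := hd p
    rw [d1, d2, d3, ← hadef, fpol]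
  rw [hset]
  simp only [hfun]
  rw [std_integral hw hw0 ha hc hR hRc hc1 hcw hRw]
  have haR : a / R₀ ≤ 1 := by
    rw [div_le_one hR]
    apply le_of_sq_le_sq _ hR.le
    linarith
  obtain ⟨θ, hθ⟩ : ∃ θ, θ = arcsin (a / R₀) := ⟨_, rfl⟩
  have hsin : sin θ = a / R₀ := by
    rw [hθ]; exact sin_arcsin (le_trans (by norm_num) (div_pos ha hR).le) haR
  have hcos : cos θ = c / R₀ := by
    rw [hθ, cos_arcsin, show 1 - (a / R₀) ^ 2 = (c / R₀) ^ 2 by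
      rw [div_pow, div_pow, hc2]; field_simp]
    exact Real.sqrt_sq (by positivity)
  have hθ2 : θ ≤ π / 2 := by rw [hθ]; exact arcsin_le_pi_div_two _
  have hθ6 : π / 6 ≤ θ := by
    rw [hθ, Real.le_arcsin_iff_sin_le' ⟨by linarith [pi_pos], by linarith [pi_pos]⟩, sin_pi_div_six,
      le_div_iff₀ hR]
    have : R₀ ≤ 2 * a := by
      apply le_of_sq_le_sq _ (by positivity)
      nlinarith
    linarith
  have hpi := pi_pos
  have hs3 : sin (π / 3) = w / 2 := by rw [sin_pi_div_three, hwdef]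
  have hs23 : sin (2 * π / 3 - θ) = sin (π / 3 + θ) := by
    rw [← sin_pi_sub]; congr 1; ring
  have key := final_alg (θ := θ) hw hRc
    (by
      rw [show R₀ ^ 2 - ((w * c - a) / 2 + a) ^ 2 = ((w * a - c) / 2) ^ 2 by
        rw [hRc]; linear_combination (-(c ^ 2 + a ^ 2) / 4) * hw]
      exact Real.sqrt_sq (by linarith))
    (by
      rw [show R₀ ^ 2 - ((w * c - a) / 2) ^ 2 = ((w * a + c) / 2) ^ 2 by
        rw [hRc]; linear_combination (-(c ^ 2 + a ^ 2) / 4) * hw]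
      exact Real.sqrt_sq (by positivity))
    hcdef.symm
    (by
      apply arcsin_eq_of_sin_eq _ ⟨by linarith, by linarith⟩
      rw [hs23, sin_add, hs3, cos_pi_div_three, hsin, hcos]
      field_simp
      ring)
    (by
      apply arcsin_eq_of_sin_eq _ ⟨by linarith, by linarith⟩
      rw [sin_sub, hs3, cos_pi_div_three, hsin, hcos]
      field_simp)
    hθ.symm
  rw [key]
  have r1 : l ^ 8 / (8 * w) = (2 * a) ^ 8 * w / 24 := by
    rw [hla]; field_simp; linear_combination (-8) * hw
  have r2 : R₀ * √(4 - l ^ 2 / R₀ ^ 2) = 2 * c := by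
    rw [show 4 - l ^ 2 / R₀ ^ 2 = (2 * c / R₀) ^ 2 by
      rw [div_pow, mul_pow, hc2, hla]; field_simp; ring, Real.sqrt_sq (by positivity)]
    field_simp
  have r3 : l / (2 * R₀) = a / R₀ := by rw [hla]; field_simp
  rw [r1, r3, ← hθ, mul_assoc (1 / 8 * l) R₀, r2, hla]
  ring
end

section
/- Let l > 0 and define, for R₀ ∈ ((√3/3)l, (√3/2)l], S_{A₁}(R₀) = R₀²( π/3 − arcsin( l/(2R₀) ) ) − (√3/3) l R₀ sin( π/3 − arcsin( l/(2R₀) ) ). Then lim_{R₀ → ((√3/3)l)⁺} S_{A₁}(R₀) / ( R₀ − (√3/3)l )² = √3, i.e. S_{A₁}(R₀) ≈ √3 ( R₀ − (√3/3)l )² as R₀ → (√3/3)l from above. -/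
open Real Filter

/-- Appendices A and B: the asymptotic `S_{A₁}(R₀) ≈ √3 (R₀ − (√3/3)l)²` as
`R₀ → ((√3/3)l)⁺`, stated as a limit of the ratio. -/
theorem SA1_asymptotics
    (l : ℝ) (hl : 0 < l)
    (S : ℝ → ℝ)
    (hS : ∀ R₀, Real.sqrt 3 / 3 * l < R₀ → R₀ ≤ Real.sqrt 3 / 2 * l →
      S R₀ = R₀ ^ 2 * (π / 3 - Real.arcsin (l / (2 * R₀)))
        - Real.sqrt 3 / 3 * l * R₀ * Real.sin (π / 3 - Real.arcsin (l / (2 * R₀)))) :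
    Tendsto (fun R₀ => S R₀ / (R₀ - Real.sqrt 3 / 3 * l) ^ 2)
      (nhdsWithin (Real.sqrt 3 / 3 * l)
        (Set.Ioc (Real.sqrt 3 / 3 * l) (Real.sqrt 3 / 2 * l)))
      (nhds (Real.sqrt 3)) := by
  have h3 : Real.sqrt 3 ^ 2 = 3 := Real.sq_sqrt (by norm_num)
  have h3p : 0 < Real.sqrt 3 := Real.sqrt_pos.mpr (by norm_num)
  set a : ℝ := Real.sqrt 3 / 3 * l with ha
  have hap : 0 < a := by positivity
  have hla : l / (2 * a) = Real.sqrt 3 / 2 := by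
    rw [ha]; field_simp; linarith
  have hasin : Real.arcsin (l / (2 * a)) = π / 3 := by
    rw [hla, ← Real.sin_pi_div_three]
    exact Real.arcsin_sin (by linarith [Real.pi_pos]) (by linarith [Real.pi_pos])
  have hlt : Real.sqrt 3 < 2 := by nlinarith
  set φ : ℝ → ℝ := fun x => π / 3 - Real.arcsin (l / (2 * x)) with hφ
  have hφa : φ a = 0 := by simp only [hφ]; rw [hasin]; ring
  have hd : HasDerivAt φ (3 / l) a := by
    have h1 : HasDerivAt (fun x : ℝ => l / (2 * x)) ((0 * (2 * a) - l * (2 * 1)) / (2 * a) ^ 2) a :=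
      (hasDerivAt_const a l).div ((hasDerivAt_id a).const_mul 2) (by positivity)
    have h2 := Real.hasDerivAt_arcsin (x := l / (2 * a))
      (by rw [hla]; linarith) (by rw [hla]; linarith)
    have h4 := (h2.comp a h1).const_sub (π / 3)
    refine h4.congr_deriv ?_
    have h5 : Real.sqrt (1 - (l / (2 * a)) ^ 2) = 1 / 2 := by
      rw [hla, show 1 - (Real.sqrt 3 / 2) ^ 2 = (1 / 2 : ℝ) ^ 2 by nlinarith]
      exact Real.sqrt_sq (by norm_num)
    have h6 : a ^ 2 = l ^ 2 / 3 := by rw [ha, mul_pow, div_pow, h3]; ring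
    rw [h5, mul_pow, h6]; field_simp; norm_num
  set F := nhdsWithin a (Set.Ioc a (Real.sqrt 3 / 2 * l)) with hF
  have hFle : F ≤ nhds a := nhdsWithin_le_nhds
  have hq : Tendsto (fun x => φ x / (x - a)) F (nhds (3 / l)) := by
    have h := (hasDerivAt_iff_tendsto_slope.mp hd).mono_left
      (nhdsWithin_mono a (s := Set.Ioc a (Real.sqrt 3 / 2 * l))
        (fun x hx => by simpa using hx.1.ne'))
    refine h.congr (fun x => ?_)
    rw [slope_def_field, hφa, sub_zero]
  have hφ0 : Tendsto φ F (nhds 0) := by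
    have := hd.continuousAt.tendsto.mono_left hFle
    rwa [hφa] at this
  have hx : Tendsto (fun x : ℝ => x) F (nhds a) := hFle
  have hr : Tendsto (fun x => (φ x - Real.sin (φ x)) / (x - a) ^ 2) F (nhds 0) := by
    have hb : Tendsto (fun x => |φ x| * (φ x / (x - a)) ^ 2) F (nhds 0) := by
      simpa using hφ0.abs.mul (hq.pow 2)
    refine squeeze_zero_norm' ?_ hb
    have hs : ∀ᶠ x in F, |φ x| < 1 := by
      have := hφ0.abs
      rw [abs_zero] at this
      exact this.eventually_lt_const one_pos
    filter_upwards [hs] with x hx1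
    have h := Real.sin_bound hx1.le
    have hk : |φ x - Real.sin (φ x)| ≤ |φ x| ^ 3 := by
      have e : φ x - Real.sin (φ x) =
        φ x ^ 3 / 6 - (Real.sin (φ x) - (φ x - φ x ^ 3 / 6)) := by ring
      have t := abs_sub (φ x ^ 3 / 6) (Real.sin (φ x) - (φ x - φ x ^ 3 / 6))
      rw [← e, abs_div, abs_pow, abs_of_pos (show (0:ℝ) < 6 by norm_num)] at t
      have h0 := pow_nonneg (abs_nonneg (φ x)) 3
      have h4 : |φ x| ^ 5 ≤ |φ x| ^ 3 := pow_le_pow_of_le_one (abs_nonneg _) hx1.le (by norm_num)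
      linarith
    rw [Real.norm_eq_abs, abs_div, abs_of_nonneg (sq_nonneg (x - a)), div_pow, ← sq_abs (φ x),
      ← mul_div_assoc]
    refine div_le_div_of_nonneg_right ?_ (sq_nonneg _)
    calc _ ≤ _ := hk
      _ = _ := by ring
  have hmain := (hx.mul hq).add ((hx.const_mul a).mul hr)
  have hlim : a * (3 / l) + a * a * 0 = Real.sqrt 3 := by rw [ha]; field_simp; ring
  rw [hlim] at hmain
  refine hmain.congr' ?_
  filter_upwards [self_mem_nhdsWithin] with x hxm
  rw [hS x hxm.1 hxm.2]
  have hne : x - a ≠ 0 := sub_ne_zero.mpr hxm.1.ne'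
  change x * (φ x / (x - a)) + a * x * ((φ x - Real.sin (φ x)) / (x - a) ^ 2) =
    (x ^ 2 * φ x - a * x * Real.sin (φ x)) / (x - a) ^ 2
  field_simp
  ring
end

section
/- Let η₀ > 0 and η_j > 0, and set t* = η_j / (η₀ + η_j + η₀η_j). For t ∈ (0, 1/(1+η₀)) define M(t) = max{ η₀ / (1 − t(1 + η₀)), η_j / t }. Then: (1) for all t ∈ (0, t*], M(t) = η_j / t, and M is strictly decreasing on (0, t*]; (2) for all t ∈ [t*, 1/(1+η₀)), M(t) = η₀ / (1 − t(1 + η₀)), and M is strictly increasing on [t*, 1/(1+η₀)); in particular the two expressions agree at t = t*, where both equal η₀ + η_j + η₀η_j. -/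
/-- Corollary 2 (underlying threshold monotonicity): with `t = β₁²`,
`M(t) = max{ η₀/(1 − t(1+η₀)), η_j/t }` equals `η_j/t` and is strictly decreasing on
`(0, t*]`, and equals `η₀/(1 − t(1+η₀))` and is strictly increasing on `[t*, 1/(1+η₀))`,
where `t* = η_j/(η₀ + η_j + η₀η_j)`; at `t*` both expressions equal `η₀ + η_j + η₀η_j`. -/
theorem threshold_monotonicity
    (η₀ ηj : ℝ) (hη₀ : 0 < η₀) (hηj : 0 < ηj)
    (tstar : ℝ) (htstar : tstar = ηj / (η₀ + ηj + η₀ * ηj))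
    (M : ℝ → ℝ)
    (hM : ∀ t ∈ Set.Ioo (0 : ℝ) (1 / (1 + η₀)),
      M t = max (η₀ / (1 - t * (1 + η₀))) (ηj / t)) :
    (∀ t ∈ Set.Ioc (0 : ℝ) tstar, M t = ηj / t) ∧
    StrictAntiOn M (Set.Ioc (0 : ℝ) tstar) ∧
    (∀ t ∈ Set.Ico tstar (1 / (1 + η₀)), M t = η₀ / (1 - t * (1 + η₀))) ∧
    StrictMonoOn M (Set.Ico tstar (1 / (1 + η₀))) ∧
    ηj / tstar = η₀ + ηj + η₀ * ηj ∧
    η₀ / (1 - tstar * (1 + η₀)) = η₀ + ηj + η₀ * ηj := by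
  have hS : 0 < η₀ + ηj + η₀ * ηj := by positivity
  have hmul : tstar * (η₀ + ηj + η₀ * ηj) = ηj := by
    rw [htstar]; field_simp
  have hpos : 0 < tstar := by rw [htstar]; positivity
  have h1 : 0 < 1 + η₀ := by linarith
  have hlt : tstar < 1 / (1 + η₀) := by
    rw [htstar, div_lt_div_iff₀ hS h1]; nlinarith
  have hden : ∀ t, t < 1 / (1 + η₀) → 0 < 1 - t * (1 + η₀) := by
    intro t ht
    have := (lt_div_iff₀ h1).mp ht
    linarith
  have A : ∀ t ∈ Set.Ioc (0 : ℝ) tstar, M t = ηj / t := by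
    rintro t ⟨h0, ht⟩
    have hl := lt_of_le_of_lt ht hlt
    rw [hM t ⟨h0, hl⟩]
    apply max_eq_right
    rw [div_le_div_iff₀ (hden t hl) h0]
    have := mul_le_mul_of_nonneg_right ht hS.le
    linarith
  have B : ∀ t ∈ Set.Ico tstar (1 / (1 + η₀)), M t = η₀ / (1 - t * (1 + η₀)) := by
    rintro t ⟨ht, hl⟩
    have h0 := lt_of_lt_of_le hpos ht
    rw [hM t ⟨h0, hl⟩]
    apply max_eq_left
    rw [div_le_div_iff₀ h0 (hden t hl)]
    have := mul_le_mul_of_nonneg_right ht hS.le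
    linarith
  refine ⟨A, ?_, B, ?_, ?_, ?_⟩
  · intro a ha b hb hab
    rw [A a ha, A b hb]
    exact div_lt_div_of_pos_left hηj ha.1 hab
  · intro a ha b hb hab
    rw [B a ha, B b hb]
    apply div_lt_div_of_pos_left hη₀ (hden b hb.2)
    have := mul_lt_mul_of_pos_right hab h1
    linarith
  · rw [div_eq_iff hpos.ne']; linarith
  · rw [div_eq_iff (hden _ hlt).ne']
    linear_combination (1 + η₀) * hmul
end

section
/- Let α > 0, M > 0, ρ > 0, β ≥ 0, and b, c > 0. Define p(r) = 1 − e^{−M r^α / ρ} · ( b / (Mβ²r^α + b) ) · ( c / (Mβ²r^α + c) ) for r ≥ 0, and define the disc-averaged outage probability P(R) = (2/R²) ∫₀^R p(r) r dr for R > 0. Then p is monotonically nondecreasing on [0, ∞), and P is monotonically nondecreasing on (0, ∞). -/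
/-- Corollary 1: the near user's conditional outage probability `p(r)` is nondecreasing in
the distance `r` to its BS, and hence the disc-averaged outage probability
`P(R) = (2/R²) ∫₀^R p(r) r dr` is nondecreasing in the disc radius `R`. -/
theorem near_user_outage_monotone_in_radius
    (α M ρ β b c : ℝ) (hα : 0 < α) (hM : 0 < M) (hρ : 0 < ρ) (hβ : 0 ≤ β)
    (hb : 0 < b) (hc : 0 < c)
    (p P : ℝ → ℝ)
    (hp : ∀ r, 0 ≤ r →
      p r = 1 - Real.exp (-(M * r ^ α / ρ)) * (b / (M * β ^ 2 * r ^ α + b))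
        * (c / (M * β ^ 2 * r ^ α + c)))
    (hP : ∀ R, 0 < R → P R = (2 / R ^ 2) * ∫ r in (0 : ℝ)..R, p r * r) :
    MonotoneOn p (Set.Ici (0 : ℝ)) ∧ MonotoneOn P (Set.Ioi (0 : ℝ)) := by
  have hmono : MonotoneOn p (Set.Ici (0 : ℝ)) := by
    intro x hx y hy hxy
    have hx0 : (0 : ℝ) ≤ x := hx
    have hy0 : (0 : ℝ) ≤ y := hy
    rw [hp x hx0, hp y hy0]
    have h1 : x ^ α ≤ y ^ α := Real.rpow_le_rpow hx0 hxy hα.le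
    have h0 : 0 ≤ x ^ α := Real.rpow_nonneg hx0 α
    have h0' : 0 ≤ y ^ α := Real.rpow_nonneg hy0 α
    gcongr
  refine ⟨hmono, ?_⟩
  have hint : ∀ a d : ℝ, 0 ≤ a → 0 ≤ d →
      IntervalIntegrable (fun r => p r * r) MeasureTheory.volume a d := by
    intro a d ha hd
    have h : IntervalIntegrable p MeasureTheory.volume a d := by
      apply MonotoneOn.intervalIntegrable
      apply hmono.mono
      intro x hx
      exact le_trans (le_min ha hd) hx.1
    exact h.mul_continuousOn continuousOn_id
  have hconst : ∀ k a d : ℝ, ∫ r in a..d, k * r = k * ((d ^ 2 - a ^ 2) / 2) := by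
    intro k a d
    rw [intervalIntegral.integral_const_mul, integral_id]
  have hci : ∀ k a d : ℝ, IntervalIntegrable (fun r => k * r) MeasureTheory.volume a d := by
    intro k a d
    exact (continuous_const.mul continuous_id).intervalIntegrable a d
  intro R hR S hS hRS
  have hR0 : (0 : ℝ) < R := hR
  have hS0 : (0 : ℝ) < S := hS
  rw [hP R hR0, hP S hS0]
  have hadd := intervalIntegral.integral_add_adjacent_intervals
    (hint 0 R le_rfl hR0.le) (hint R S hR0.le hS0.le)
  have hI : ∫ r in (0 : ℝ)..R, p r * r ≤ p R * ((R ^ 2 - 0 ^ 2) / 2) := by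
    rw [← hconst]
    apply intervalIntegral.integral_mono_on hR0.le (hint 0 R le_rfl hR0.le) (hci _ _ _)
    intro x hx
    exact mul_le_mul_of_nonneg_right (hmono hx.1 hR0.le hx.2) hx.1
  have hJ : p R * ((S ^ 2 - R ^ 2) / 2) ≤ ∫ r in R..S, p r * r := by
    rw [← hconst]
    apply intervalIntegral.integral_mono_on hRS (hci _ _ _) (hint R S hR0.le hS0.le)
    intro x hx
    have hx0 : 0 ≤ x := hR0.le.trans hx.1
    exact mul_le_mul_of_nonneg_right (hmono hR0.le hx0 hx.1) hx0
  rw [← hadd]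
  generalize (∫ r in (0 : ℝ)..R, p r * r) = I at *
  generalize (∫ r in R..S, p r * r) = J at *
  rw [div_mul_eq_mul_div, div_mul_eq_mul_div, div_le_div_iff₀ (by positivity) (by positivity)]
  have hd : 0 ≤ S ^ 2 - R ^ 2 := by nlinarith
  have e1 := mul_le_mul_of_nonneg_left hI hd
  have e2 := mul_le_mul_of_nonneg_left hJ (sq_nonneg R)
  nlinarith
end
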